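/- New sum rule from the Gross–Witten sum rule via the Szegő map: Let −1 ≤ g ≤ 0 and let μ_g = |g|·𝒟 + (1−|g|)·Arcsine, where 𝒟 is the measure with density (1/2π)·√((2−x)/(2+x)) on (−2,2). For every nontrivial probability measure μ on [−2,2] with canonical moments (u_k)_{k≥1} and u₀ = −1: K(μ_g | μ) = H(g) + g/2 − (g/2)·∑_{k=1}^∞ (u_k − u_{k−1})² + ∑_{k=1}^∞ [−log(1−u_k²) + g·u_k²], where H(g) = 1 − √(1−g²) + log((1+√(1−g²))/2), and where both sides may be infinite simultaneously. -/

import Mathlib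

open MeasureTheory Real Filter Set Topology Polynomial
open scoped ENNReal ComplexConjugate

noncomputable section

namespace SumRules

-- Kullback–Leibler divergence `K(ν | μ)`.
open Classical in
def KLdiv {α : Type*} [MeasurableSpace α] (ν μ : Measure α) : ℝ≥0∞ :=
  if ν ≪ μ ∧ Integrable (llr ν μ) ν then ENNReal.ofReal (∫ x, llr ν μ x ∂ν) else ⊤

/-- The (topological) support of a measure. -/
def suppSet {α : Type*} [TopologicalSpace α] [MeasurableSpace α] (μ : Measure α) : Set α :=
  {x | ∀ U ∈ nhds x, μ U ≠ 0}

/-- A measure is nontrivial if its support is infinite, i.e. it is not carried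
by any finite set. -/
def InfiniteSupport {α : Type*} [MeasurableSpace α] (μ : Measure α) : Prop :=
  ∀ s : Finset α, μ (↑s : Set α)ᶜ ≠ 0

/-- The set of support points outside `[cm, cp]`. -/
def ES (μ : Measure ℝ) (cm cp : ℝ) : Set ℝ := suppSet μ \ Icc cm cp

/-- `μ ∈ 𝒮₁(cm, cp)`: the support of `μ` is contained in `[cm, cp]` together with an
at most countable set of points outside this interval. -/
def InS1 (μ : Measure ℝ) (cm cp : ℝ) : Prop := (ES μ cm cp).Countable

/-- `a b` (indexed so that `a (k+1) = a_{k+1}`, `b (k+1) = b_{k+1}`, `k ≥ 0`) are the Jacobi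
coefficients of `μ`: there is a sequence of orthonormal polynomials (with positive leading
coefficients, obtained by Gram-Schmidt from `1, x, x², …`) satisfying the three-term recursion. -/
def IsJacobi (μ : Measure ℝ) (a b : ℕ → ℝ) : Prop :=
  (∀ k : ℕ, 0 < a (k+1)) ∧
  ∃ p : ℕ → Polynomial ℝ,
    (∀ k, (p k).natDegree = k) ∧ (∀ k, 0 < (p k).leadingCoeff) ∧
    (∀ j k, ∫ x, (p j).eval x * (p k).eval x ∂μ = if j = k then 1 else 0) ∧
    (∀ (k : ℕ) (x : ℝ), x * (p k).eval x =
      a (k+1) * (p (k+1)).eval x + b (k+1) * (p k).eval x +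
        (if k = 0 then 0 else a k * (p (k-1)).eval x))

/-- `u` is the sequence of canonical moments of a measure on `[-2,2]` (with `u 0 = -1`). -/
def IsCanonicalMoments (μ : Measure ℝ) (u : ℕ → ℝ) : Prop :=
  u 0 = -1 ∧ (∀ k : ℕ, u (k+1) ∈ Ioo (-1 : ℝ) 1) ∧
  ∃ a b : ℕ → ℝ, IsJacobi μ a b ∧
    (∀ k : ℕ, b (k+1) = (1 - u (2*k)) * u (2*k+1) - (1 + u (2*k)) * u (2*k-1)) ∧
    (∀ k : ℕ, (a (k+1))^2 = (1 - u (2*k)) * (1 - (u (2*k+1))^2) * (1 + u (2*k+2)))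

/-- `z` is the sequence of canonical coefficients of a measure supported in `[0,∞)`. -/
def IsCanonicalZ (μ : Measure ℝ) (z : ℕ → ℝ) : Prop :=
  z 0 = 0 ∧ (∀ k : ℕ, 0 ≤ z (k+1)) ∧
  ∃ a b : ℕ → ℝ, IsJacobi μ a b ∧
    (∀ k : ℕ, b (k+1) = z (2*k) + z (2*k+1)) ∧
    (∀ k : ℕ, (a (k+1))^2 = z (2*k+1) * z (2*k+2))

def Gfun (x : ℝ) : ℝ := x - 1 - Real.log x

/-- The semicircle law. -/
def SCm : Measure ℝ :=
  volume.withDensity fun x => ENNReal.ofReal (Real.sqrt (4 - x^2) / (2*π))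

/-- The arcsine law on `(-2,2)`. -/
def ArcsineM : Measure ℝ :=
  volume.withDensity fun x => ENNReal.ofReal (1 / (π * Real.sqrt (4 - x^2)))

/-- The measure with density `(2/(π|q-p|)) √((x-p)/(q-x))` between `p` and `q`. -/
def Dmeas (p q : ℝ) : Measure ℝ :=
  volume.withDensity fun x => ENNReal.ofReal (2/(π * |q - p|) * Real.sqrt ((x - p)/(q - x)))

/-- The point `e^{iθ}` on the unit circle. -/
def ctheta (θ : ℝ) : ℂ := Complex.exp (θ * Complex.I)

/-- Reversed polynomial `Φ*` with conjugated coefficients: `Φ*(z) = z^k conj(Φ(1/conj z))`. -/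
def polyStar (P : Polynomial ℂ) : Polynomial ℂ := (P.map (starRingEnd ℂ)).reverse

/-- `α` is the sequence of Verblunsky coefficients of the measure `ν` on the unit circle
(`ν` being given in angle coordinates, carried by `[0, 2π)`): the monic orthogonal
polynomials of `ν` satisfy the Szegő recursion with coefficients `α`. -/
def IsVerblunsky (ν : Measure ℝ) (α : ℕ → ℂ) : Prop :=
  (∀ k, ‖α k‖ < 1) ∧
  ∃ Φ : ℕ → Polynomial ℂ,
    (∀ k, (Φ k).Monic) ∧ (∀ k, (Φ k).natDegree = k) ∧
    (∀ j k, j ≠ k →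
      ∫ θ, conj ((Φ j).eval (ctheta θ)) * (Φ k).eval (ctheta θ) ∂ν = 0) ∧
    (∀ k, Φ (k+1) = Polynomial.X * Φ k - Polynomial.C (conj (α k)) * polyStar (Φ k))

/-- `γ` is the sequence of deformed Verblunsky coefficients of `ν`. -/
def IsDeformedVerblunsky (ν : Measure ℝ) (γ : ℕ → ℂ) : Prop :=
  ∃ α : ℕ → ℂ, IsVerblunsky ν α ∧
    ∀ k : ℕ, γ k = conj (α k) * ∏ j ∈ Finset.range k, (1 - conj (γ j)) / (1 - γ j)

/-- Symmetry of a measure on the circle (in angle coordinates): invariance under conjugation. -/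
def SymmCircle (ν : Measure ℝ) : Prop :=
  (ν.map ctheta).map (starRingEnd ℂ) = ν.map ctheta

/-- The uniform measure on the circle, in angle coordinates. -/
def UNIFm : Measure ℝ :=
  volume.withDensity fun θ => ENNReal.ofReal (if 0 ≤ θ ∧ θ < 2*π then 1/(2*π) else 0)

end SumRules

namespace SumRules

/-- Outlier contribution for the Killip–Simon sum rule (`+∞` inside `(-2,2)`). -/
def FSC (x : ℝ) : ℝ≥0∞ :=
  if 2 ≤ |x| then
    ENNReal.ofReal (|x|/2 * Real.sqrt (x^2 - 4) - 2 * Real.log ((|x| + Real.sqrt (x^2 - 4))/2))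
  else ⊤

/-- Coefficient side of the Killip–Simon sum rule. -/
def IH (a b : ℕ → ℝ) : ℝ≥0∞ :=
  (1/2 : ℝ≥0∞) * ∑' k : ℕ, ENNReal.ofReal ((b (k+1))^2)
    + ∑' k : ℕ, ENNReal.ofReal (Gfun ((a (k+1))^2))

def tauM (τ : ℝ) : ℝ := (1 - Real.sqrt τ)^2
def tauP (τ : ℝ) : ℝ := (1 + Real.sqrt τ)^2

/-- The Marchenko–Pastur law with parameter `τ`. -/
def MPm (τ : ℝ) : Measure ℝ :=
  volume.withDensity fun x =>
    ENNReal.ofReal (Real.sqrt ((x - tauM τ) * (tauP τ - x)) / (2*π*τ*x))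

/-- Outlier contribution for the Marchenko–Pastur sum rule. -/
def FMP (τ : ℝ) (x : ℝ) : ℝ≥0∞ :=
  if tauP τ ≤ x then
    ENNReal.ofReal (∫ t in (tauP τ)..x, Real.sqrt ((t - tauP τ) * (t - tauM τ)) / (τ*t))
  else if 0 < x ∧ x ≤ tauM τ then
    ENNReal.ofReal (∫ t in x..(tauM τ), Real.sqrt ((t - tauP τ) * (t - tauM τ)) / (τ*t))
  else ⊤

/-- Coefficient side of the Marchenko–Pastur sum rule. -/
def IL (τ : ℝ) (z : ℕ → ℝ) : ℝ≥0∞ :=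
  ∑' k : ℕ, ENNReal.ofReal (τ⁻¹ * Gfun (z (2*k+1)) + Gfun (τ⁻¹ * z (2*k+2)))

def uPl (κ₁ κ₂ : ℝ) : ℝ :=
  2*(κ₂^2 - κ₁^2 + 4*Real.sqrt ((1+κ₁)*(1+κ₂)*(1+κ₁+κ₂)))/(2+κ₁+κ₂)^2
def uMi (κ₁ κ₂ : ℝ) : ℝ :=
  2*(κ₂^2 - κ₁^2 - 4*Real.sqrt ((1+κ₁)*(1+κ₂)*(1+κ₁+κ₂)))/(2+κ₁+κ₂)^2

/-- The Kesten–McKay law with parameters `κ₁, κ₂`. -/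
def KMKm (κ₁ κ₂ : ℝ) : Measure ℝ :=
  volume.withDensity fun x =>
    ENNReal.ofReal ((2+κ₁+κ₂)/(2*π) * Real.sqrt ((x - uMi κ₁ κ₂) * (uPl κ₁ κ₂ - x)) / (4 - x^2))

def ue (κ₁ κ₂ : ℝ) : ℝ := -(κ₁+κ₂)/(2+κ₁+κ₂)
def uo (κ₁ κ₂ : ℝ) : ℝ := (κ₂-κ₁)/(2+κ₁+κ₂)

def He (κ₁ κ₂ u : ℝ) : ℝ :=
  -(1+κ₁+κ₂) * Real.log ((1-u)/(1 - ue κ₁ κ₂)) - Real.log ((1+u)/(1 + ue κ₁ κ₂))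
def Ho (κ₁ κ₂ u : ℝ) : ℝ :=
  -(1+κ₁) * Real.log ((1-u)/(1 - uo κ₁ κ₂)) - (1+κ₂) * Real.log ((1+u)/(1 + uo κ₁ κ₂))

/-- Coefficient side of the Kesten–McKay sum rule. -/
def IJ (κ₁ κ₂ : ℝ) (u : ℕ → ℝ) : ℝ≥0∞ :=
  ∑' k : ℕ, (ENNReal.ofReal (Ho κ₁ κ₂ (u (2*k+1))) + ENNReal.ofReal (He κ₁ κ₂ (u (2*k+2))))

/-- Outlier contribution for the Kesten–McKay sum rule. -/
def FKMK (κ₁ κ₂ : ℝ) (x : ℝ) : ℝ≥0∞ :=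
  if uPl κ₁ κ₂ ≤ x then
    ENNReal.ofReal (∫ t in (uPl κ₁ κ₂)..x,
      (2+κ₁+κ₂) * Real.sqrt ((t - uPl κ₁ κ₂) * (t - uMi κ₁ κ₂)) / (4 - t^2))
  else if x ≤ uMi κ₁ κ₂ then
    ENNReal.ofReal (∫ t in x..(uMi κ₁ κ₂),
      (2+κ₁+κ₂) * Real.sqrt ((t - uPl κ₁ κ₂) * (t - uMi κ₁ κ₂)) / (4 - t^2))
  else ⊤

def Hgw (g : ℝ) : ℝ := 1 - Real.sqrt (1 - g^2) + Real.log ((1 + Real.sqrt (1 - g^2))/2)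

def thetaG (g : ℝ) : ℝ := 2 * Real.arcsin (Real.sqrt (1/|g|))

/-- The Gross–Witten measures, in angle coordinates. -/
def GWm (g : ℝ) : Measure ℝ :=
  if |g| ≤ 1 then
    volume.withDensity fun θ =>
      ENNReal.ofReal (if 0 ≤ θ ∧ θ < 2*π then (1 + g * Real.cos θ)/(2*π) else 0)
  else if g < -1 then
    volume.withDensity fun θ => ENNReal.ofReal (
      if π - thetaG g ≤ θ ∧ θ ≤ π + thetaG g then
        |g| / π * Real.sin (θ/2) * Real.sqrt (Real.sin (θ/2)^2 - Real.cos (thetaG g/2)^2)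
      else 0)
  else
    volume.withDensity fun θ => ENNReal.ofReal (
      if -thetaG g ≤ θ ∧ θ ≤ thetaG g then
        g/π * Real.cos (θ/2) * Real.sqrt (Real.sin (thetaG g/2)^2 - Real.sin (θ/2)^2)
      else 0)

def thetaD (d : ℝ) : ℝ := 2 * Real.arcsin (d/(1+d))
def gammaD (d : ℝ) : ℝ := -d/(1+d)

/-- The Hua–Pickrell measure, in angle coordinates. -/
def HPm (d : ℝ) : Measure ℝ :=
  volume.withDensity fun θ => ENNReal.ofReal (
    if thetaD d < θ ∧ θ < 2*π - thetaD d then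
      (1+d) * Real.sqrt (Real.sin (θ/2)^2 - Real.sin (thetaD d/2)^2) / (2*π*Real.sin (θ/2))
    else 0)

/-- The entropy-like function appearing in the Hua–Pickrell sum rule. -/
def HHP (d : ℝ) (γ : ℂ) : ℝ :=
  -Real.log ((1 - ‖γ‖^2)/(1 - (gammaD d)^2)) - 2*d*Real.log (‖1 - γ‖/(1 - gammaD d))

/-- Outlier contribution for the Hua–Pickrell sum rule (in angle coordinates). -/
def FHP (d : ℝ) (θ : ℝ) : ℝ≥0∞ :=
  if θ ≤ thetaD d then
    ENNReal.ofReal (∫ φ in θ..(thetaD d),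
      (1+d) * Real.sqrt (Real.sin (thetaD d/2)^2 - Real.sin (φ/2)^2) / Real.sin (φ/2))
  else if 2*π - thetaD d ≤ θ then
    ENNReal.ofReal (∫ φ in (2*π - thetaD d)..θ,
      (1+d) * Real.sqrt (Real.sin (thetaD d/2)^2 - Real.sin (φ/2)^2) / Real.sin (φ/2))
  else ⊤

/-- Set of outlying support points for a measure on the circle, in angle coordinates. -/
def EST (ν : Measure ℝ) (tm tp : ℝ) : Set ℝ := suppSet ν \ Icc tm tp

/-- `ν ∈ 𝒮₁^𝕋(tm, tp)` (in angle coordinates). -/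
def InS1T (ν : Measure ℝ) (tm tp : ℝ) : Prop := (EST ν tm tp).Countable

/-- The measure `𝒟(2,-2)`, with density `(1/2π)√((2-x)/(2+x))` on `(-2,2)`
(a shift of the hard-edge Marchenko–Pastur law). -/
def Dhard : Measure ℝ :=
  volume.withDensity fun x => ENNReal.ofReal (Real.sqrt ((2 - x)/(2 + x)) / (2*π))

/-- The mixture `μ_g = |g| 𝒟(2,-2) + (1-|g|) Arcsine`. -/
def mugMix (g : ℝ) : Measure ℝ :=
  ENNReal.ofReal |g| • Dhard + ENNReal.ofReal (1 - |g|) • ArcsineM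

/-- The mixture `ρ_g = |g| SC + (1-|g|) Arcsine`. -/
def rhog (g : ℝ) : Measure ℝ :=
  ENNReal.ofReal |g| • SCm + ENNReal.ofReal (1 - |g|) • ArcsineM

def Cg (g : ℝ) : ℝ :=
  -|g| * (1 - Real.log 2) + 1 - Real.sqrt (1 - g^2) + Real.log ((1 + Real.sqrt (1 - g^2))/2)

/-- The measure with density `(1/2π)(2+x)^{3/2}(2-x)^{1/2}` on `[-2,2]`. -/
def muHat : Measure ℝ :=
  volume.withDensity fun x =>
    ENNReal.ofReal ((2 + x) * Real.sqrt (2 + x) * Real.sqrt (2 - x) / (2*π))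

/-- The Poisson kernel measure `Pois(ζ)`, in angle coordinates. -/
def PoisM (ζ : ℂ) : Measure ℝ :=
  volume.withDensity fun θ => ENNReal.ofReal (
    if 0 ≤ θ ∧ θ < 2*π then (1 - ‖ζ‖^2)/(2*π*‖ctheta θ - ζ‖^2) else 0)

/-- The Carathéodory function of a measure on the circle (angle coordinates). -/
def Cara (ν : Measure ℝ) (z : ℂ) : ℂ := ∫ θ, (ctheta θ + z)/(ctheta θ - z) ∂ν

/-- `f` is the Schur function of `ν`. -/
def IsSchurFn (ν : Measure ℝ) (f : ℂ → ℂ) : Prop :=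
  DifferentiableOn ℂ f (Metric.ball 0 1) ∧
  (∀ z ∈ Metric.ball (0:ℂ) 1, ‖f z‖ ≤ 1) ∧
  (∀ z ∈ Metric.ball (0:ℂ) 1, Cara ν z - 1 = z * f z * (Cara ν z + 1))

/-- Möbius transform of the unit disk. -/
def mtrans (ρ z : ℂ) : ℂ := (z - ρ)/(1 - conj ρ * z)

def npRaw (ρ : ℂ) (g : ℂ → ℂ) (z : ℂ) : ℂ :=
  ((-ρ/(‖ρ‖ : ℂ)) / mtrans ρ z) * ((g z - g ρ)/(1 - conj (g ρ) * g z))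

-- One step of the Nevanlinna–Pick algorithm at `ρ` (the removable singularity at `ρ`
-- is filled in by the limit).
open Classical in
def npStep (ρ : ℂ) (g : ℂ → ℂ) : ℂ → ℂ := fun z =>
  if z = ρ then limUnder (𝓝[≠] ρ) (npRaw ρ g) else npRaw ρ g z

def schurRaw (g : ℂ → ℂ) (z : ℂ) : ℂ := ((g z - g 0)/z)/(1 - conj (g 0) * g z)

-- One step of the classical Schur algorithm (the removable singularity at `0`
-- is filled in by the limit).
open Classical in
def schurStep (g : ℂ → ℂ) : ℂ → ℂ := fun z =>
  if z = 0 then limUnder (𝓝[≠] (0:ℂ)) (schurRaw g) else schurRaw g z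

def xdHP (d : ℝ) : ℝ := 2*(1 + 2*d - d^2)/(1+d)^2

def uKMK (d : ℝ) : ℝ := 2*Real.sqrt (1 + 2*d)/(1+d)

end SumRules

namespace SumRules

/-- Szego recursion: the pair `(Φ_n, Φ_n^*)`. -/
def sz (u : ℕ → ℝ) : ℕ → ℝ[X] × ℝ[X]
  | 0 => (1, 1)
  | n+1 => (X * (sz u n).1 - C (u (n+1)) * (sz u n).2,
            (sz u n).2 - C (u (n+1)) * (X * (sz u n).1))

def ph (u : ℕ → ℝ) (n : ℕ) (z : ℂ) : ℂ := aeval z (sz u n).1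
def ps (u : ℕ → ℝ) (n : ℕ) (z : ℂ) : ℂ := aeval z (sz u n).2

lemma ph_zero (u : ℕ → ℝ) (z : ℂ) : ph u 0 z = 1 := by simp [ph, sz]
lemma ps_zero (u : ℕ → ℝ) (z : ℂ) : ps u 0 z = 1 := by simp [ps, sz]
lemma ph_succ (u : ℕ → ℝ) (n : ℕ) (z : ℂ) :
    ph u (n+1) z = z * ph u n z - (u (n+1) : ℂ) * ps u n z := by simp [ph, ps, sz]
lemma ps_succ (u : ℕ → ℝ) (n : ℕ) (z : ℂ) :
    ps u (n+1) z = ps u n z - (u (n+1) : ℂ) * (z * ph u n z) := by simp [ph, ps, sz]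

lemma ph_differentiable (u : ℕ → ℝ) (n : ℕ) : Differentiable ℂ (ph u n) := by
  unfold ph; exact Polynomial.differentiable_aeval _
lemma ps_differentiable (u : ℕ → ℝ) (n : ℕ) : Differentiable ℂ (ps u n) := by
  unfold ps; exact Polynomial.differentiable_aeval _

lemma ph_conj (u : ℕ → ℝ) (n : ℕ) (z : ℂ) : ph u n (conj z) = conj (ph u n z) := by
  unfold ph; exact Polynomial.aeval_conj _ _
lemma ps_conj (u : ℕ → ℝ) (n : ℕ) (z : ℂ) : ps u n (conj z) = conj (ps u n z) := by
  unfold ps; exact Polynomial.aeval_conj _ _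

lemma ps_at_zero (u : ℕ → ℝ) (n : ℕ) : ps u n 0 = 1 := by
  induction n with
  | zero => exact ps_zero u 0
  | succ n ih => rw [ps_succ, ih]; simp

lemma ph_at_zero (u : ℕ → ℝ) (h0 : u 0 = -1) (n : ℕ) : ph u n 0 = -(u n : ℂ) := by
  cases n with
  | zero => rw [ph_zero, h0]; simp
  | succ n => rw [ph_succ, ps_at_zero]; simp

lemma ps_deriv_zero (u : ℕ → ℝ) (h0 : u 0 = -1) (n : ℕ) :
    HasDerivAt (ps u n) ((∑ k ∈ Finset.range n, u (k+1) * u k : ℝ) : ℂ) 0 := by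
  induction n with
  | zero =>
    have : ps u 0 = fun _ => 1 := by funext z; exact ps_zero u z
    rw [this]; simpa using hasDerivAt_const (0:ℂ) (1:ℂ)
  | succ n ih =>
    have : ps u (n+1) = fun z => ps u n z - (u (n+1) : ℂ) * (z * ph u n z) := by
      funext z; exact ps_succ u n z
    rw [this]
    have h2 := (ph_differentiable u n 0).hasDerivAt
    have h3 := ih.sub ((((hasDerivAt_id (0:ℂ)).mul h2)).const_mul (u (n+1) : ℂ))
    refine h3.congr_deriv ?_
    rw [Finset.sum_range_succ]
    simp [ph_at_zero u h0]

lemma sz_natDegree (u : ℕ → ℝ) (n : ℕ) :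
    (sz u n).1.natDegree ≤ n ∧ (sz u n).2.natDegree ≤ n := by
  induction n with
  | zero => simp [sz]
  | succ n ih =>
    have h1 : (X * (sz u n).1).natDegree ≤ n + 1 := by
      refine natDegree_mul_le.trans ?_
      have := natDegree_X_le (R := ℝ)
      omega
    constructor
    · refine (natDegree_sub_le _ _).trans (max_le h1 ?_)
      exact (natDegree_C_mul_le _ _).trans (by omega)
    · refine (natDegree_sub_le _ _).trans (max_le (by omega) ?_)
      exact (natDegree_C_mul_le _ _).trans h1

lemma sz_norm (u : ℕ → ℝ) (hu : ∀ k : ℕ, u (k+1) ∈ Ioo (-1 : ℝ) 1) (n : ℕ) (z : ℂ)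
    (hz : ‖z‖ ≤ 1) : ‖ph u n z‖ ≤ ‖ps u n z‖ ∧ ps u n z ≠ 0 := by
  induction n with
  | zero => simp [ph_zero, ps_zero]
  | succ n ih =>
    obtain ⟨h1, h2⟩ := ih
    have hα := hu n
    have hlt : |u (n+1)| < 1 := abs_lt.mpr hα
    have hpos : 0 < ‖ps u n z‖ := norm_pos_iff.mpr h2
    have hw : ‖z * ph u n z‖ ≤ ‖ps u n z‖ := by
      rw [norm_mul]
      nlinarith [norm_nonneg (ph u n z), norm_nonneg z]
    constructor
    · rw [ph_succ, ps_succ]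
      rw [← sq_le_sq₀ (norm_nonneg _) (norm_nonneg _)]
      have e : ‖ps u n z - (u (n+1) : ℂ) * (z * ph u n z)‖^2
          - ‖z * ph u n z - (u (n+1) : ℂ) * ps u n z‖^2
          = (1 - u (n+1)^2) * (‖ps u n z‖^2 - ‖z * ph u n z‖^2) := by
        generalize z * ph u n z = w
        generalize ps u n z = v
        simp only [Complex.sq_norm, Complex.normSq_apply, Complex.sub_re, Complex.sub_im,
          Complex.re_ofReal_mul, Complex.im_ofReal_mul]
        ring
      have h3 : ‖z * ph u n z‖^2 ≤ ‖ps u n z‖^2 := by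
        gcongr
      have h4 : 0 ≤ 1 - u (n+1)^2 := by nlinarith [hα.1, hα.2]
      nlinarith [mul_nonneg h4 (sub_nonneg.mpr h3)]
    · rw [ps_succ]
      intro h
      have h5 : ps u n z = (u (n+1) : ℂ) * (z * ph u n z) := sub_eq_zero.mp h
      have h6 : ‖ps u n z‖ = |u (n+1)| * ‖z * ph u n z‖ := by
        conv_lhs => rw [h5]
        rw [norm_mul, Complex.norm_real, Real.norm_eq_abs]
      nlinarith [abs_nonneg (u (n+1)), norm_nonneg (z * ph u n z)]

lemma sz_circle (u : ℕ → ℝ) (n : ℕ) (z : ℂ) (hz : ‖z‖ = 1) :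
    z^n * conj (ps u n z) = ph u n z ∧ z^n * conj (ph u n z) = ps u n z := by
  have hzz : z * conj z = 1 := by
    rw [Complex.mul_conj, Complex.normSq_eq_norm_sq, hz]; simp
  induction n with
  | zero => simp [ph_zero, ps_zero]
  | succ n ih =>
    obtain ⟨h1, h2⟩ := ih
    rw [ph_succ, ps_succ]
    simp only [map_sub, map_mul, Complex.conj_ofReal]
    constructor
    · linear_combination z * h1 - (u (n+1) : ℂ) * h2 - (u (n+1) : ℂ) * z^n * conj (ph u n z) * hzz
    · linear_combination h2 - (u (n+1) : ℂ) * z * h1 + z^n * conj (ph u n z) * hzz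

lemma norm_ps_eq (u : ℕ → ℝ) (n : ℕ) (z : ℂ) (hz : ‖z‖ = 1) : ‖ph u n z‖ = ‖ps u n z‖ := by
  rw [← (sz_circle u n z hz).1]; simp [hz]

lemma image_two_cos : (fun θ : ℝ => 2 * Real.cos θ) '' (Ioo 0 π) = Ioo (-2) 2 := by
  ext x
  constructor
  · rintro ⟨θ, ⟨h1, h2⟩, rfl⟩
    have hs : 0 < Real.sin θ := Real.sin_pos_of_pos_of_lt_pi h1 h2
    have := Real.sin_sq_add_cos_sq θ
    constructor <;> simp only <;> nlinarith
  · rintro ⟨h1, h2⟩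
    refine ⟨Real.arccos (x/2), ⟨Real.arccos_pos.mpr (by linarith), ?_⟩, ?_⟩
    · refine lt_of_le_of_ne (Real.arccos_le_pi _) ?_
      intro h
      rw [Real.arccos_eq_pi] at h
      linarith
    · simp only
      rw [Real.cos_arccos (by linarith) (by linarith)]; ring

lemma arc_map : ArcsineM = ENNReal.ofReal (1/π) •
    Measure.map (fun θ : ℝ => 2 * Real.cos θ) (volume.restrict (Ioo 0 π)) := by
  have hm : Measurable (fun θ : ℝ => 2 * Real.cos θ) := by fun_prop
  ext s hs
  set d : ℝ → ℝ≥0∞ := fun x => ENNReal.ofReal (1 / (π * Real.sqrt (4 - x^2))) with hd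
  have h1 : ArcsineM s = ∫⁻ x in Ioo (-2) 2, s.indicator d x := by
    unfold ArcsineM
    rw [withDensity_apply _ hs, ← lintegral_indicator hs, ← lintegral_indicator measurableSet_Ioo]
    refine lintegral_congr fun x => ?_
    by_cases hx : x ∈ Ioo (-2 : ℝ) 2
    · rw [indicator_of_mem hx]
    · rw [indicator_of_notMem hx]
      by_cases hxs : x ∈ s
      · rw [indicator_of_mem hxs]
        have : 4 - x^2 ≤ 0 := by
          rw [mem_Ioo, not_and_or, not_lt, not_lt] at hx
          rcases hx with h | h <;> nlinarith
        simp [Real.sqrt_eq_zero_of_nonpos this]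
      · rw [indicator_of_notMem hxs]
  rw [h1, ← image_two_cos]
  rw [lintegral_image_eq_lintegral_abs_deriv_mul (f' := fun θ => 2 * (-Real.sin θ)) measurableSet_Ioo]
  · rw [Measure.smul_apply, Measure.map_apply hm hs, Measure.restrict_apply (hm hs), smul_eq_mul,
      ← setLIntegral_const, ← setLIntegral_indicator (hm hs)]
    refine setLIntegral_congr_fun measurableSet_Ioo fun θ hθ => ?_
    have hsn : 0 < Real.sin θ := Real.sin_pos_of_pos_of_lt_pi hθ.1 hθ.2
    by_cases h : 2 * Real.cos θ ∈ s
    · have h' : θ ∈ (fun θ : ℝ => 2 * Real.cos θ) ⁻¹' s := h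
      rw [indicator_of_mem h, indicator_of_mem h', hd]
      simp only
      rw [← ENNReal.ofReal_mul (abs_nonneg _)]
      congr 1
      have e : 4 - (2 * Real.cos θ)^2 = (2 * Real.sin θ)^2 := by
        have := Real.sin_sq_add_cos_sq θ
        nlinarith
      rw [e, Real.sqrt_sq (by positivity), abs_of_nonpos (by linarith)]
      field_simp
    · have h' : θ ∉ (fun θ : ℝ => 2 * Real.cos θ) ⁻¹' s := h
      rw [indicator_of_notMem h, indicator_of_notMem h', mul_zero]
  · intro θ _
    exact ((Real.hasDerivAt_cos θ).const_mul 2).hasDerivWithinAt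
  · intro a ha b hb hab
    simp only at hab
    exact Real.injOn_cos ⟨ha.1.le, ha.2.le⟩ ⟨hb.1.le, hb.2.le⟩ (by linarith)

instance arc_prob : IsProbabilityMeasure ArcsineM := by
  constructor
  rw [arc_map, Measure.smul_apply, Measure.map_apply (by fun_prop) MeasurableSet.univ]
  simp only [preimage_univ, Measure.restrict_apply_univ, Real.volume_Ioo, smul_eq_mul, sub_zero]
  rw [← ENNReal.ofReal_mul (by positivity)]
  simp [Real.pi_ne_zero]

lemma arc_supp : ArcsineM (Icc (-2) 2)ᶜ = 0 := by
  rw [arc_map, Measure.smul_apply, Measure.map_apply (by fun_prop) measurableSet_Icc.compl]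
  have : (fun θ : ℝ => 2 * Real.cos θ) ⁻¹' (Icc (-2) 2)ᶜ = ∅ := by
    ext θ
    simp only [mem_preimage, mem_compl_iff, mem_Icc, mem_empty_iff_false, iff_false, not_not]
    constructor <;> nlinarith [Real.neg_one_le_cos θ, Real.cos_le_one θ]
  rw [this]; simp

lemma restrict_Icc_eq {m : Measure ℝ} (hm : m (Icc (-2) 2)ᶜ = 0) : m.restrict (Icc (-2) 2) = m := by
  apply Measure.restrict_eq_self_of_ae_mem
  rw [ae_iff]; exact hm

lemma cont_integrable {m : Measure ℝ} [IsFiniteMeasure m] (hm : m (Icc (-2) 2)ᶜ = 0) {f : ℝ → ℝ}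
    (hf : ContinuousOn f (Icc (-2) 2)) : Integrable f m := by
  have := hf.integrableOn_compact (μ := m) isCompact_Icc
  rwa [IntegrableOn, restrict_Icc_eq hm] at this

lemma ae_Icc {m : Measure ℝ} (hm : m (Icc (-2) 2)ᶜ = 0) : ∀ᵐ x ∂m, x ∈ Icc (-2 : ℝ) 2 := by
  rw [ae_iff]; exact hm

/-- The point on the upper half circle above `x/2`. -/
def ez (x : ℝ) : ℂ := Complex.exp (Real.arccos (x/2) * Complex.I)

lemma ez_cont : Continuous ez := by
  unfold ez
  have := Real.continuous_arccos
  fun_prop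

lemma ez_norm (x : ℝ) : ‖ez x‖ = 1 := by
  unfold ez; exact Complex.norm_exp_ofReal_mul_I _

lemma ez_re {x : ℝ} (hx : x ∈ Icc (-2 : ℝ) 2) : (ez x).re = x/2 := by
  unfold ez
  rw [Complex.exp_ofReal_mul_I_re, Real.cos_arccos (by linarith [hx.1]) (by linarith [hx.2])]

lemma ez_ne (x : ℝ) : ez x ≠ 0 := by unfold ez; exact Complex.exp_ne_zero _

lemma ez_mul_conj (x : ℝ) : ez x * conj (ez x) = 1 := by
  rw [Complex.mul_conj, Complex.normSq_eq_norm_sq, ez_norm]; simp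

lemma ez_inv (x : ℝ) : (ez x)⁻¹ = conj (ez x) := by
  rw [inv_eq_of_mul_eq_one_right (ez_mul_conj x)]

lemma ez_add_inv {x : ℝ} (hx : x ∈ Icc (-2 : ℝ) 2) : ez x + (ez x)⁻¹ = x := by
  rw [ez_inv, Complex.add_conj, ez_re hx]; push_cast; ring

lemma arc_integral {f : ℝ → ℝ} (hf : Continuous f) :
    ∫ x, f x ∂ArcsineM = 1/π * ∫ θ in (0:ℝ)..π, f (2 * Real.cos θ) := by
  rw [arc_map, integral_smul_measure, integral_map (by fun_prop) hf.aestronglyMeasurable,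
    intervalIntegral.integral_of_le Real.pi_pos.le, integral_Ioc_eq_integral_Ioo,
    ENNReal.toReal_ofReal (by positivity), smul_eq_mul]

/-- Mean value property in terms of the arcsine law. -/
lemma arc_mean {G : ℂ → ℂ} (hG : DiffContOnCl ℂ G (Metric.ball 0 1))
    (hc : ∀ z, ‖z‖ = 1 → (G (conj z)).re = (G z).re) :
    ∫ x, (G (ez x)).re ∂ArcsineM = (G 0).re := by
  have hGc : ContinuousOn G (Metric.closedBall 0 1) := by
    have := hG.continuousOn
    rwa [closure_ball (0:ℂ) one_ne_zero] at this
  have hcont : Continuous fun x => (G (ez x)).re := by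
    refine Complex.continuous_re.comp (hGc.comp_continuous ez_cont fun x => ?_)
    simp [ez_norm]
  have hcont2 : Continuous fun θ : ℝ => G (circleMap 0 1 θ) := by
    refine hGc.comp_continuous (continuous_circleMap 0 1) fun x => ?_
    simp
  have hmv := DiffContOnCl.circleAverage (f := G) (c := 0) (R := 1) (by simpa using hG)
  rw [← hmv, Real.circleAverage_def, arc_integral hcont]
  have h1 : ∫ θ in (0:ℝ)..π, (G (ez (2 * Real.cos θ))).re = ∫ θ in (0:ℝ)..π, (G (circleMap 0 1 θ)).re := by
    refine intervalIntegral.integral_congr fun θ hθ => ?_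
    rw [uIcc_of_le Real.pi_pos.le] at hθ
    congr 2
    unfold ez
    rw [mul_div_cancel_left₀ _ (two_ne_zero), Real.arccos_cos hθ.1 hθ.2]
    simp [circleMap]
  have hii : ∀ a b : ℝ, IntervalIntegrable (fun θ : ℝ => (G (circleMap 0 1 θ)).re) volume a b :=
    fun a b => (Complex.continuous_re.comp hcont2).intervalIntegrable a b
  have h2 : (∫ θ in (0:ℝ)..(2*π), G (circleMap 0 1 θ)).re =
      ∫ θ in (0:ℝ)..(2*π), (G (circleMap 0 1 θ)).re := by
    have := Complex.reCLM.intervalIntegral_comp_comm (hcont2.intervalIntegrable (μ := volume) 0 (2*π))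
    simpa using this.symm
  have h3 : ∫ θ in π..(2*π), (G (circleMap 0 1 θ)).re = ∫ θ in (0:ℝ)..π, (G (circleMap 0 1 θ)).re := by
    have := intervalIntegral.integral_comp_sub_left (a := 0) (b := π)
      (fun θ : ℝ => (G (circleMap 0 1 θ)).re) (2*π)
    rw [show 2*π - π = π by ring, sub_zero] at this
    rw [← this]
    refine intervalIntegral.integral_congr fun θ _ => ?_
    have e : circleMap 0 1 (2*π - θ) = conj (circleMap 0 1 θ) := by
      simp only [circleMap, zero_add, Complex.ofReal_one, one_mul]
      rw [← Complex.exp_conj]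
      push_cast
      rw [sub_mul, Complex.exp_sub, Complex.exp_two_pi_mul_I, map_mul, Complex.conj_I,
        Complex.conj_ofReal, mul_neg, Complex.exp_neg, one_div]
    show (G _).re = _
    rw [e, hc _ (by simp)]
  have h4 := intervalIntegral.integral_add_adjacent_intervals (hii 0 π) (hii π (2*π))
  rw [h1, Complex.smul_re, h2, ← h4, h3, smul_eq_mul]
  field_simp
  ring

lemma exists_log {P : ℂ → ℂ} (hP : Differentiable ℂ P) (h0 : ∀ z, ‖z‖ ≤ 1 → P z ≠ 0)
    (h1 : P 0 = 1) : ∃ F : ℂ → ℂ, ∃ R : ℝ, 1 < R ∧ DifferentiableOn ℂ F (Metric.ball 0 R) ∧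
      F 0 = 0 ∧ deriv F 0 = deriv P 0 ∧ ∀ z ∈ Metric.ball (0:ℂ) R, P z = Complex.exp (F z) := by
  have hopen : IsOpen {z | P z ≠ 0} := isOpen_ne.preimage hP.continuous
  obtain ⟨δ, hδ, hsub⟩ := (isCompact_closedBall (0:ℂ) 1).exists_thickening_subset_open hopen
    (fun z hz => h0 z (by simpa using hz))
  rw [thickening_closedBall hδ zero_le_one] at hsub
  have hd : DifferentiableOn ℂ (fun z => deriv P z / P z) (Metric.ball 0 (δ + 1)) := by
    intro z hz
    exact ((hP.analyticAt z).deriv.differentiableAt.div (hP z) (hsub hz)).differentiableWithinAt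
  obtain ⟨F, hF0, hF⟩ := hd.isExactOn_ball.with_val_at 0 0
  have hmem : (0:ℂ) ∈ Metric.ball (0:ℂ) (δ+1) := by simp; linarith
  refine ⟨F, δ + 1, by linarith, fun z hz => (hF z hz).differentiableAt.differentiableWithinAt,
    hF0, ?_, ?_⟩
  · rw [(hF 0 hmem).deriv, h1, div_one]
  · intro z hz
    have hc : ∀ w ∈ Metric.ball (0:ℂ) (δ+1), HasDerivAt (fun w => P w * Complex.exp (-F w)) 0 w := by
      intro w hw
      have := (hP w).hasDerivAt.mul ((hF w hw).neg.cexp)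
      refine this.congr_deriv ?_
      have hne : P w ≠ 0 := hsub hw
      field_simp
      ring
    have hconst := Metric.isOpen_ball.is_const_of_deriv_eq_zero (𝕜 := ℂ)
      (convex_ball (0:ℂ) (δ+1)).isPreconnected
      (f := fun w => P w * Complex.exp (-F w))
      (fun w hw => (hc w hw).differentiableAt.differentiableWithinAt)
      (fun w hw => (hc w hw).deriv) hz hmem
    simp only [h1, hF0, neg_zero, Complex.exp_zero, mul_one] at hconst
    rw [Complex.exp_neg] at hconst
    field_simp at hconst
    exact hconst

lemma arc_log {P : ℂ → ℂ} (hP : Differentiable ℂ P) (h0 : ∀ z, ‖z‖ ≤ 1 → P z ≠ 0)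
    (h1 : P 0 = 1) (hc : ∀ z, P (conj z) = conj (P z)) :
    ∫ x, Real.log (‖P (ez x)‖^2) ∂ArcsineM = 0 ∧
    ∫ x, x/2 * Real.log (‖P (ez x)‖^2) ∂ArcsineM = (deriv P 0).re := by
  obtain ⟨F, R, hR, hF, hF0, hFd, hPF⟩ := exists_log hP h0 h1
  have hsub : Metric.closedBall (0:ℂ) 1 ⊆ Metric.ball 0 R := Metric.closedBall_subset_ball hR
  have hmem : (0:ℂ) ∈ Metric.ball (0:ℂ) R := by simp; linarith
  have hlog : ∀ z : ℂ, ‖z‖ = 1 → Real.log (‖P z‖^2) = 2 * (F z).re := by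
    intro z hz
    rw [hPF z (hsub (by simp [hz])), Complex.norm_exp, Real.log_pow, Real.log_exp]; simp
  have hsym : ∀ z : ℂ, ‖z‖ = 1 → (F (conj z)).re = (F z).re := by
    intro z hz
    have a := hlog z hz
    have b := hlog (conj z) (by simpa using hz)
    rw [hc, RCLike.norm_conj] at b
    linarith
  have hdc : ∀ {G : ℂ → ℂ}, DifferentiableOn ℂ G (Metric.ball 0 R) →
      DiffContOnCl ℂ G (Metric.ball 0 1) := by
    intro G hG
    refine DifferentiableOn.diffContOnCl (hG.mono ?_)
    rw [closure_ball (0:ℂ) one_ne_zero]; exact hsub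
  constructor
  · have := arc_mean (hdc (hF.const_mul 2)) (fun z hz => by simp [hsym z hz])
    rw [hF0] at this
    simp only [mul_zero, Complex.zero_re] at this
    rw [← this]
    refine integral_congr_ae (ae_of_all _ fun x => ?_)
    simp [hlog (ez x) (ez_norm x)]
  · have hF1 : DifferentiableOn ℂ (dslope F 0) (Metric.ball 0 R) :=
      (Complex.differentiableOn_dslope (Metric.isOpen_ball.mem_nhds hmem)).mpr hF
    have hG : DifferentiableOn ℂ (fun z => (z^2 + 1) * dslope F 0 z) (Metric.ball 0 R) := by
      refine DifferentiableOn.mul ?_ hF1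
      fun_prop
    have hval : ∀ z : ℂ, ‖z‖ = 1 → ((z^2 + 1) * dslope F 0 z).re = 2 * z.re * (F z).re := by
      intro z hz
      have hz0 : z ≠ 0 := by intro h; simp [h] at hz
      have hzz : z * conj z = 1 := by
        rw [Complex.mul_conj, Complex.normSq_eq_norm_sq, hz]; simp
      have e : (z^2 + 1) * dslope F 0 z = ((2 * z.re : ℝ) : ℂ) * F z := by
        rw [dslope_of_ne _ hz0, slope_def_field, hF0, ← Complex.add_conj, sub_zero, sub_zero]
        have : conj z = z⁻¹ := by rw [eq_comm]; exact inv_eq_of_mul_eq_one_right hzz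
        rw [this]; field_simp
      rw [e, Complex.re_ofReal_mul]
    have := arc_mean (hdc hG) (fun z hz => by
      rw [hval z hz, hval (conj z) (by simpa using hz), hsym z hz]; simp)
    rw [dslope_same, hFd] at this
    simp only [ne_eq, OfNat.ofNat_ne_zero, not_false_eq_true, zero_pow, zero_add, one_mul] at this
    rw [← this]
    refine integral_congr_ae ?_
    filter_upwards [ae_Icc arc_supp] with x hx
    rw [hval _ (ez_norm x), hlog (ez x) (ez_norm x), ez_re hx]
    ring

def kap (u : ℕ → ℝ) (n : ℕ) : ℝ := ∏ k ∈ Finset.range n, (1 - u (k+1)^2)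

lemma one_sub_sq_pos {u : ℕ → ℝ} (hu : ∀ k : ℕ, u (k+1) ∈ Ioo (-1 : ℝ) 1) (k : ℕ) :
    0 < 1 - u (k+1)^2 := by
  have := hu k
  nlinarith [this.1, this.2]

lemma kap_pos {u : ℕ → ℝ} (hu : ∀ k : ℕ, u (k+1) ∈ Ioo (-1 : ℝ) 1) (n : ℕ) : 0 < kap u n :=
  Finset.prod_pos fun k _ => one_sub_sq_pos hu k

lemma kap_succ (u : ℕ → ℝ) (n : ℕ) : kap u (n+1) = kap u n * (1 - u (n+1)^2) :=
  Finset.prod_range_succ _ _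

/-- density of the Bernstein-Szego approximation w.r.t. the arcsine law -/
def dn (u : ℕ → ℝ) (N : ℕ) (x : ℝ) : ℝ := kap u N / ‖ps u N (ez x)‖^2

lemma ps_ez_ne {u : ℕ → ℝ} (hu : ∀ k : ℕ, u (k+1) ∈ Ioo (-1 : ℝ) 1) (N : ℕ) (x : ℝ) :
    ps u N (ez x) ≠ 0 := (sz_norm u hu N (ez x) (ez_norm x).le).2

lemma ps_ez_cont (u : ℕ → ℝ) (N : ℕ) : Continuous fun x => ps u N (ez x) :=
  (ps_differentiable u N).continuous.comp ez_cont
lemma ph_ez_cont (u : ℕ → ℝ) (N : ℕ) : Continuous fun x => ph u N (ez x) :=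
  (ph_differentiable u N).continuous.comp ez_cont

lemma dn_pos {u : ℕ → ℝ} (hu : ∀ k : ℕ, u (k+1) ∈ Ioo (-1 : ℝ) 1) (N : ℕ) (x : ℝ) :
    0 < dn u N x := by
  have := norm_pos_iff.mpr (ps_ez_ne hu N x)
  have := kap_pos hu N
  unfold dn; positivity

lemma dn_cont {u : ℕ → ℝ} (hu : ∀ k : ℕ, u (k+1) ∈ Ioo (-1 : ℝ) 1) (N : ℕ) :
    Continuous (dn u N) := by
  unfold dn
  refine Continuous.div continuous_const ((ps_ez_cont u N).norm.pow 2) fun x => ?_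
  have := norm_pos_iff.mpr (ps_ez_ne hu N x)
  positivity

def ell (u : ℕ → ℝ) (N : ℕ) (f : ℝ → ℂ) : ℝ := ∫ x, (f x).re * dn u N x ∂ArcsineM

section
variable {u : ℕ → ℝ} (hu : ∀ k : ℕ, u (k+1) ∈ Ioo (-1 : ℝ) 1)

lemma ell_int (hu : ∀ k : ℕ, u (k+1) ∈ Ioo (-1 : ℝ) 1) (N : ℕ) {f : ℝ → ℂ} (hf : Continuous f) :
    Integrable (fun x => (f x).re * dn u N x) ArcsineM :=
  cont_integrable arc_supp ((Complex.continuous_re.comp hf).mul (dn_cont hu N)).continuousOn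

lemma ell_add (hu : ∀ k : ℕ, u (k+1) ∈ Ioo (-1 : ℝ) 1) (N : ℕ) {f g : ℝ → ℂ} (hf : Continuous f)
    (hg : Continuous g) : ell u N (fun x => f x + g x) = ell u N f + ell u N g := by
  unfold ell
  rw [← integral_add (ell_int hu N hf) (ell_int hu N hg)]
  simp only [Complex.add_re, add_mul]

lemma ell_smul (u : ℕ → ℝ) (N : ℕ) (c : ℝ) (f : ℝ → ℂ) :
    ell u N (fun x => (c : ℂ) * f x) = c * ell u N f := by
  unfold ell
  rw [← integral_const_mul]
  simp only [Complex.re_ofReal_mul, mul_assoc]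

lemma ell_sum (hu : ∀ k : ℕ, u (k+1) ∈ Ioo (-1 : ℝ) 1) (N : ℕ) (s : Finset ℕ) {f : ℕ → ℝ → ℂ}
    (hf : ∀ i, Continuous (f i)) :
    ell u N (fun x => ∑ i ∈ s, f i x) = ∑ i ∈ s, ell u N (f i) := by
  unfold ell
  rw [← integral_finsetSum s (fun i _ => ell_int hu N (hf i))]
  simp only [Complex.re_sum, Finset.sum_mul]

lemma ell_congr_re (u : ℕ → ℝ) (N : ℕ) {f g : ℝ → ℂ} (h : ∀ x, (f x).re = (g x).re) :
    ell u N f = ell u N g := by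
  unfold ell; simp only [h]

lemma ell_pow (hu : ∀ k : ℕ, u (k+1) ∈ Ioo (-1 : ℝ) 1) (N j : ℕ) :
    ∫ x, ((ez x)^j / ps u N (ez x)).re ∂ArcsineM = if j = 0 then 1 else 0 := by
  have hd : DiffContOnCl ℂ (fun z => z^j / ps u N z) (Metric.ball 0 1) := by
    apply DifferentiableOn.diffContOnCl
    rw [closure_ball (0:ℂ) one_ne_zero]
    intro z hz
    refine (DifferentiableAt.div (by fun_prop) (ps_differentiable u N z) ?_).differentiableWithinAt
    exact (sz_norm u hu N z (by simpa using hz)).2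
  rw [arc_mean hd (fun z _ => by
    rw [ps_conj, ← map_pow, ← map_div₀, Complex.conj_re])]
  rw [ps_at_zero]
  split_ifs with h
  · simp [h]
  · simp [h]

lemma ell_base_ps (hu : ∀ k : ℕ, u (k+1) ∈ Ioo (-1 : ℝ) 1) (N j : ℕ) :
    ell u N (fun x => (conj (ez x))^j * ps u N (ez x)) = if j = 0 then kap u N else 0 := by
  have : (if j = 0 then kap u N else 0) = kap u N * (if j = 0 then 1 else 0) := by
    split_ifs <;> simp
  rw [this, ← ell_pow hu N j, ← integral_const_mul]
  unfold ell
  refine integral_congr_ae (ae_of_all _ fun x => ?_)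
  have hne := ps_ez_ne hu N x
  have e : (ez x)^j / ps u N (ez x) =
      (((‖ps u N (ez x)‖^2)⁻¹ : ℝ) : ℂ) * conj ((conj (ez x))^j * ps u N (ez x)) := by
    have h2 : ps u N (ez x) * conj (ps u N (ez x)) = ((‖ps u N (ez x)‖^2 : ℝ) : ℂ) := by
      rw [Complex.mul_conj, Complex.normSq_eq_norm_sq]
    have h3 : conj (ps u N (ez x)) ≠ 0 := by simpa using hne
    rw [Complex.ofReal_inv, ← h2]
    simp only [map_mul, map_pow, Complex.conj_conj]
    field_simp
  simp only
  rw [e, Complex.re_ofReal_mul, Complex.conj_re]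
  unfold dn
  ring

lemma conj_pow_ps (u : ℕ → ℝ) (n : ℕ) (x : ℝ) :
    (conj (ez x))^n * ps u n (ez x) = conj (ph u n (ez x)) ∧
    (conj (ez x))^n * ph u n (ez x) = conj (ps u n (ez x)) := by
  have h := sz_circle u n (ez x) (ez_norm x)
  have h1 : (conj (ez x))^n * (ez x)^n = 1 := by
    rw [← mul_pow, mul_comm, ez_mul_conj, one_pow]
  constructor
  · rw [← h.2, ← mul_assoc, h1, one_mul]
  · rw [← h.1, ← mul_assoc, h1, one_mul]

lemma conj_pow_split (x : ℝ) {i d : ℕ} (h : i ≤ d) :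
    (conj (ez x))^d * (ez x)^i = (conj (ez x))^(d-i) := by
  obtain ⟨k, rfl⟩ := Nat.exists_eq_add_of_le h
  rw [Nat.add_sub_cancel_left, pow_add, mul_right_comm, ← mul_pow, mul_comm (conj (ez x)) (ez x),
    ez_mul_conj, one_pow, one_mul]

lemma ell_base_ph (hu : ∀ k : ℕ, u (k+1) ∈ Ioo (-1 : ℝ) 1) (N j : ℕ) (hj : j ≤ N) :
    ell u N (fun x => (conj (ez x))^j * ph u N (ez x)) = if j = N then kap u N else 0 := by
  have : (if j = N then kap u N else 0) = if N - j = 0 then kap u N else 0 := by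
    congr 1; simp; omega
  rw [this, ← ell_base_ps hu N (N - j)]
  refine ell_congr_re u N fun x => ?_
  rw [← Complex.conj_re]
  congr 1
  rw [← (sz_circle u N (ez x) (ez_norm x)).1]
  simp only [map_mul, map_pow, Complex.conj_conj]
  rw [← conj_pow_split x hj]
  ring

lemma ell_orth (hu : ∀ k : ℕ, u (k+1) ∈ Ioo (-1 : ℝ) 1) (N : ℕ) (k : ℕ) : ∀ m, m + k = N →
    (∀ j, j ≤ m → ell u N (fun x => (conj (ez x))^j * ph u m (ez x)) = if j = m then kap u m else 0) ∧
    (∀ j, j ≤ m → ell u N (fun x => (conj (ez x))^j * ps u m (ez x)) = if j = 0 then kap u m else 0) := by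
  induction k with
  | zero =>
    intro m hm
    have : m = N := by omega
    subst this
    exact ⟨fun j hj => ell_base_ph hu m j hj, fun j _ => ell_base_ps hu m j⟩
  | succ k ih =>
    intro m hm
    obtain ⟨h1, h2⟩ := ih (m+1) (by omega)
    have hα := one_sub_sq_pos hu m
    have hcc : Continuous fun x => conj (ez x) := Complex.continuous_conj.comp ez_cont
    have c1 : ∀ j, Continuous fun x => (conj (ez x))^j * ph u (m+1) (ez x) := fun j =>
      (hcc.pow j).mul (ph_ez_cont u (m+1))
    have c2 : ∀ j, Continuous fun x => (conj (ez x))^j * ps u (m+1) (ez x) := fun j =>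
      (hcc.pow j).mul (ps_ez_cont u (m+1))
    have B : ∀ j, j ≤ m → ell u N (fun x => (conj (ez x))^j * ps u m (ez x))
        = if j = 0 then kap u m else 0 := by
      intro j hj
      have e := ell_smul u N (1 - u (m+1)^2) (fun x => (conj (ez x))^j * ps u m (ez x))
      have e2 : (fun x => ((1 - u (m+1)^2 : ℝ) : ℂ) * ((conj (ez x))^j * ps u m (ez x))) =
          fun x => (conj (ez x))^j * ps u (m+1) (ez x) +
            ((u (m+1) : ℝ) : ℂ) * ((conj (ez x))^j * ph u (m+1) (ez x)) := by
        funext x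
        rw [ps_succ, ph_succ]; push_cast; ring
      have c1' : Continuous fun x => ((u (m+1) : ℝ) : ℂ) * ((conj (ez x))^j * ph u (m+1) (ez x)) :=
        continuous_const.mul (c1 j)
      rw [e2, ell_add hu N (c2 j) c1', ell_smul, h1 j (by omega),
        h2 j (by omega), if_neg (show ¬ j = m + 1 by omega)] at e
      have : ell u N (fun x => (conj (ez x))^j * ps u m (ez x)) =
          (if j = 0 then kap u (m+1) else 0) / (1 - u (m+1)^2) := by
        rw [eq_div_iff hα.ne']; linarith
      rw [this, kap_succ]
      split_ifs <;> field_simp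
      simp
    refine ⟨?_, B⟩
    intro j hj
    by_cases hjm : j = m
    · subst hjm
      rw [if_pos rfl]
      have := B 0 (by omega)
      rw [if_pos rfl] at this
      rw [← this]
      refine ell_congr_re u N fun x => ?_
      rw [(conj_pow_ps u j x).2]; simp
    · rw [if_neg hjm]
      have e := ell_smul u N (1 - u (m+1)^2) (fun x => (conj (ez x))^j * ph u m (ez x))
      have e2 : (fun x => ((1 - u (m+1)^2 : ℝ) : ℂ) * ((conj (ez x))^j * ph u m (ez x))) =
          fun x => (conj (ez x))^(j+1) * ph u (m+1) (ez x) +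
            ((u (m+1) : ℝ) : ℂ) * ((conj (ez x))^(j+1) * ps u (m+1) (ez x)) := by
        funext x
        rw [ps_succ, ph_succ]; push_cast
        have := ez_mul_conj x
        linear_combination (-(conj (ez x))^j * ph u m (ez x) * (1 - (u (m+1):ℂ)^2)) * this
      have c2' : Continuous fun x => ((u (m+1) : ℝ) : ℂ) *
          ((conj (ez x))^(j+1) * ps u (m+1) (ez x)) := continuous_const.mul (c2 _)
      rw [e2, ell_add hu N (c1 _) c2', ell_smul, h1 _ (by omega),
        h2 _ (by omega), if_neg (by omega), if_neg (by omega)] at e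
      have e' : (1 - u (m+1)^2) * ell u N (fun x => (conj (ez x))^j * ph u m (ez x)) = 0 := by
        linarith
      exact (mul_eq_zero.mp e').resolve_left hα.ne'

lemma ell_poly (hu : ∀ k : ℕ, u (k+1) ∈ Ioo (-1 : ℝ) 1) {N m d : ℕ} (hm : m ≤ N) (hd : d ≤ m)
    (p : ℝ[X]) (hp : p.natDegree ≤ d) :
    ell u N (fun x => (conj (ez x))^d * ph u m (ez x) * aeval (ez x) p) =
      if d = m then p.coeff 0 * kap u m else 0 := by
  have hcc : Continuous fun x => conj (ez x) := Complex.continuous_conj.comp ez_cont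
  have e : (fun x => (conj (ez x))^d * ph u m (ez x) * aeval (ez x) p) =
      fun x => ∑ i ∈ Finset.range (d+1), ((p.coeff i : ℝ) : ℂ) *
        ((conj (ez x))^(d-i) * ph u m (ez x)) := by
    funext x
    rw [aeval_eq_sum_range' (Nat.lt_succ_of_le hp), Finset.mul_sum]
    refine Finset.sum_congr rfl fun i hi => ?_
    rw [← conj_pow_split x (Nat.lt_succ_iff.mp (Finset.mem_range.mp hi)), Complex.real_smul]
    ring
  have hci : ∀ i, Continuous fun x => ((p.coeff i : ℝ) : ℂ) *
        ((conj (ez x))^(d-i) * ph u m (ez x)) :=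
    fun i => continuous_const.mul ((hcc.pow _).mul (ph_ez_cont u m))
  rw [e, ell_sum hu N _ hci]
  have ho := (ell_orth hu N (N - m) m (by omega)).1
  have : ∀ i ∈ Finset.range (d+1), ell u N (fun x => ((p.coeff i : ℝ) : ℂ) *
        ((conj (ez x))^(d-i) * ph u m (ez x))) =
        if i = 0 then (if d = m then p.coeff 0 * kap u m else 0) else 0 := by
    intro i hi
    have := Finset.mem_range.mp hi
    rw [ell_smul, ho (d-i) (by omega)]
    by_cases h0 : i = 0
    · subst h0; simp
    · rw [if_neg h0, if_neg (by omega), mul_zero]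
  rw [Finset.sum_congr rfl this]
  simp

lemma ell_q (hu : ∀ k : ℕ, u (k+1) ∈ Ioo (-1 : ℝ) 1) {N n : ℕ} (hn : n ≤ N) :
    ∫ x, (dn u n x)⁻¹ * dn u N x ∂ArcsineM = 1 := by
  have h := ell_poly hu hn le_rfl (sz u n).2 (sz_natDegree u n).2
  rw [if_pos rfl] at h
  have h0 : (sz u n).2.coeff 0 = 1 := by
    have := ps_at_zero u n
    unfold ps at this
    rw [← Polynomial.coeff_zero_eq_aeval_zero'] at this
    simpa using this
  rw [h0, one_mul] at h
  have hk := kap_pos hu n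
  rw [← mul_right_inj' hk.ne', ← integral_const_mul, mul_one]
  refine Eq.trans ?_ h
  unfold ell
  refine integral_congr_ae (ae_of_all _ fun x => ?_)
  have : (conj (ez x))^n * ph u n (ez x) * aeval (ez x) (sz u n).2 =
      ((‖ps u n (ez x)‖^2 : ℝ) : ℂ) := by
    rw [(conj_pow_ps u n x).2]
    change conj (ps u n (ez x)) * ps u n (ez x) = _
    rw [mul_comm, Complex.mul_conj, Complex.normSq_eq_norm_sq]
  simp only
  rw [this, Complex.ofReal_re]
  unfold dn
  field_simp

lemma ell_xq (hu : ∀ k : ℕ, u (k+1) ∈ Ioo (-1 : ℝ) 1) (h0 : u 0 = -1) {N n : ℕ} (hn : n + 1 ≤ N) :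
    ∫ x, x/2 * (dn u n x)⁻¹ * dn u N x ∂ArcsineM = -(u (n+1) * u n) := by
  have h1 := ell_poly hu hn (Nat.le_succ n) (sz u n).2 (sz_natDegree u n).2
  rw [if_neg (by omega)] at h1
  have h2 := ell_poly hu (show n ≤ N by omega) le_rfl (sz u n).1 (sz_natDegree u n).1
  rw [if_pos rfl] at h2
  have h3 : (sz u n).1.coeff 0 = - u n := by
    have := ph_at_zero u h0 n
    unfold ph at this
    rw [← Polynomial.coeff_zero_eq_aeval_zero'] at this
    have h := congrArg Complex.re this
    simpa using h
  rw [h3] at h2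
  have hk := kap_pos hu n
  have hcc : Continuous fun x => conj (ez x) := Complex.continuous_conj.comp ez_cont
  have hsum := ell_add hu N
    (f := fun x => (conj (ez x))^n * ph u (n+1) (ez x) * aeval (ez x) (sz u n).2)
    (g := fun x => ((u (n+1) : ℝ) : ℂ) * ((conj (ez x))^n * ph u n (ez x) * aeval (ez x) (sz u n).1))
    (((hcc.pow _).mul (ph_ez_cont u _)).mul (ps_ez_cont u n))
    (continuous_const.mul (((hcc.pow _).mul (ph_ez_cont u _)).mul (ph_ez_cont u n)))
  rw [h1, ell_smul, h2] at hsum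
  rw [← mul_right_inj' hk.ne', ← integral_const_mul]
  rw [show kap u n * -(u (n+1) * u n) = 0 + u (n+1) * (-u n * kap u n) by ring, ← hsum]
  unfold ell
  refine integral_congr_ae ?_
  filter_upwards [ae_Icc arc_supp] with x hx
  have e : ((conj (ez x))^n * ph u (n+1) (ez x) * aeval (ez x) (sz u n).2 +
      ((u (n+1) : ℝ) : ℂ) * ((conj (ez x))^n * ph u n (ez x) * aeval (ez x) (sz u n).1)).re =
      x/2 * ‖ps u n (ez x)‖^2 := by
    change ((conj (ez x))^n * ph u (n+1) (ez x) * ps u n (ez x) +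
      ((u (n+1) : ℝ) : ℂ) * ((conj (ez x))^n * ph u n (ez x) * ph u n (ez x))).re = _
    have e1 : (conj (ez x))^n * ph u (n+1) (ez x) * ps u n (ez x) =
        ez x * ((‖ps u n (ez x)‖^2 : ℝ) : ℂ)
          - ((u (n+1) : ℝ) : ℂ) * (ps u n (ez x) * conj (ph u n (ez x))) := by
      have a : ((‖ps u n (ez x)‖^2 : ℝ) : ℂ) = ps u n (ez x) * conj (ps u n (ez x)) := by
        rw [Complex.mul_conj, Complex.normSq_eq_norm_sq]
      rw [ph_succ, a, ← (conj_pow_ps u n x).1, ← (conj_pow_ps u n x).2]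
      ring
    rw [e1, (conj_pow_ps u n x).2]
    rw [mul_comm (conj (ps u n (ez x))) (ph u n (ez x))]
    simp only [Complex.add_re, Complex.sub_re, Complex.re_ofReal_mul, Complex.re_mul_ofReal, ez_re hx]
    simp only [Complex.mul_re, Complex.conj_re, Complex.conj_im]
    ring
  rw [e]
  unfold dn
  field_simp
end

lemma jac_link {u a b : ℕ → ℝ} (h0 : u 0 = -1) (_hu : ∀ k : ℕ, u (k+1) ∈ Ioo (-1 : ℝ) 1)
    (hb : ∀ k : ℕ, b (k+1) = (1 - u (2*k)) * u (2*k+1) - (1 + u (2*k)) * u (2*k-1))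
    (ha2 : ∀ k : ℕ, (a (k+1))^2 = (1 - u (2*k)) * (1 - (u (2*k+1))^2) * (1 + u (2*k+2)))
    {z x : ℂ} (_hz : z ≠ 0) (hx : z * x = z^2 + 1) {q : ℕ → ℂ}
    (hq : ∀ k : ℕ, x * q k = a (k+1) * q (k+1) + b (k+1) * q k +
        (if k = 0 then 0 else a k * q (k-1))) (k : ℕ) :
    q k * (∏ i ∈ Finset.range k, (a (i+1) : ℂ)) * (1 - u (2*k)) * z^k =
      q 0 * (ph u (2*k) z + ps u (2*k) z) ∧
    q (k+1) * (∏ i ∈ Finset.range (k+1), (a (i+1) : ℂ)) * z^(k+1) =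
      q 0 * (z^2 * ph u (2*k) z + ps u (2*k) z - u (2*k+1) * z * (ph u (2*k) z + ps u (2*k) z)) := by
  induction k with
  | zero =>
    have hb0 := hb 0
    have hq0 := hq 0
    simp only [mul_zero, zero_add, h0, if_true] at hb0 hq0
    constructor
    · simp [h0, ph_zero, ps_zero]
    · simp only [Finset.prod_range_one, mul_zero, zero_add, ph_zero, ps_zero]
      have hb' : (b 1 : ℂ) = 2 * u 1 := by
        rw [hb0]; push_cast; ring
      rw [hb'] at hq0
      linear_combination (-z) * hq0 + q 0 * hx
  | succ k ih =>
    obtain ⟨S, T⟩ := ih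
    have e1 : ph u (2*(k+1)) z = z * (z * ph u (2*k) z - u (2*k+1) * ps u (2*k) z)
        - u (2*k+2) * (ps u (2*k) z - u (2*k+1) * (z * ph u (2*k) z)) := by
      rw [show 2*(k+1) = 2*k+1+1 by ring, ph_succ, ph_succ, ps_succ]
    have e2 : ps u (2*(k+1)) z = (ps u (2*k) z - u (2*k+1) * (z * ph u (2*k) z))
        - u (2*k+2) * (z * (z * ph u (2*k) z - u (2*k+1) * ps u (2*k) z)) := by
      rw [show 2*(k+1) = 2*k+1+1 by ring, ps_succ, ph_succ, ps_succ]
    constructor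
    · rw [e1, e2, show 2*(k+1) = 2*k+2 by ring]
      linear_combination (1 - (u (2*k+2) : ℂ)) * T
    · have hq1 := hq (k+1)
      rw [if_neg (by omega), Nat.add_sub_cancel] at hq1
      have hb1 : (b (k+1+1) : ℂ) = (1 - u (2*k+2)) * u (2*k+3) - (1 + u (2*k+2)) * u (2*k+1) := by
        rw [hb (k+1), show 2*(k+1) = 2*k+2 by ring, show 2*k+2-1 = 2*k+1 by omega]; push_cast; ring
      have ha1 : (a (k+1) : ℂ)^2 = (1 - u (2*k)) * (1 - (u (2*k+1))^2) * (1 + u (2*k+2)) := by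
        rw [← Complex.ofReal_pow, ha2 k]; push_cast; ring
      have key : q (k+1+1) * (∏ i ∈ Finset.range (k+1+1), (a (i+1) : ℂ)) * z^(k+1+1) =
          (z^2 + 1 - b (k+1+1) * z) * (q (k+1) * (∏ i ∈ Finset.range (k+1), (a (i+1) : ℂ)) * z^(k+1))
          - (1 - (u (2*k+1))^2) * (1 + u (2*k+2)) * z^2 *
            (q k * (∏ i ∈ Finset.range k, (a (i+1) : ℂ)) * (1 - u (2*k)) * z^k) := by
        rw [Finset.prod_range_succ _ (k+1), ← hx]
        rw [Finset.prod_range_succ _ k]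
        linear_combination (-(∏ i ∈ Finset.range k, (a (i+1) : ℂ)) * a (k+1) * z^(k+2)) * hq1
          - (∏ i ∈ Finset.range k, (a (i+1) : ℂ)) * q k * z^(k+2) * ha1
      rw [key, T, S, hb1, e1, e2, show 2*(k+1)+1 = 2*k+3 by ring]
      ring

lemma jac_zero {u a b : ℕ → ℝ} (h0 : u 0 = -1) (hu : ∀ k : ℕ, u (k+1) ∈ Ioo (-1 : ℝ) 1)
    (hb : ∀ k : ℕ, b (k+1) = (1 - u (2*k)) * u (2*k+1) - (1 + u (2*k)) * u (2*k-1))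
    (ha2 : ∀ k : ℕ, (a (k+1))^2 = (1 - u (2*k)) * (1 - (u (2*k+1))^2) * (1 + u (2*k+2)))
    (ha : ∀ k : ℕ, 0 < a (k+1)) {p : ℕ → ℝ[X]} (hp0 : (p 0).natDegree = 0)
    (hp : ∀ (k : ℕ) (x : ℝ), x * (p k).eval x =
      a (k+1) * (p (k+1)).eval x + b (k+1) * (p k).eval x +
        (if k = 0 then 0 else a k * (p (k-1)).eval x)) {k N : ℕ} (hk : 1 ≤ k) (hkN : 2 * k ≤ N) :
    ∫ x, (p k).eval x * dn u N x ∂ArcsineM = 0 := by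
  set C : ℝ := (∏ i ∈ Finset.range k, a (i+1)) * (1 - u (2*k)) with hC
  have hC0 : C ≠ 0 := by
    refine mul_ne_zero (Finset.prod_pos fun i _ => ha i).ne' ?_
    have := (hu (2*k-1)).2
    rw [show 2*k-1+1 = 2*k by omega] at this
    linarith
  have hcc : Continuous fun x => conj (ez x) := Complex.continuous_conj.comp ez_cont
  have ho := ell_orth hu N (N - 2*k) (2*k) (by omega)
  have hadd := ell_add hu N (f := fun x => (conj (ez x))^k * ph u (2*k) (ez x))
    (g := fun x => (conj (ez x))^k * ps u (2*k) (ez x))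
    ((hcc.pow _).mul (ph_ez_cont u _)) ((hcc.pow _).mul (ps_ez_cont u _))
  rw [ho.1 k (by omega), ho.2 k (by omega), if_neg (by omega), if_neg (by omega)] at hadd
  have hs := ell_smul u N ((p 0).coeff 0) (fun x => (conj (ez x))^k * ph u (2*k) (ez x) +
    (conj (ez x))^k * ps u (2*k) (ez x))
  rw [hadd] at hs
  have : C * ∫ x, (p k).eval x * dn u N x ∂ArcsineM = 0 := by
    rw [← integral_const_mul]
    refine Eq.trans ?_ (hs.trans (by simp))
    unfold ell
    refine integral_congr_ae ?_
    filter_upwards [ae_Icc arc_supp] with x hx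
    have hzx : ez x * (x : ℂ) = ez x^2 + 1 := by
      rw [← ez_add_inv hx, mul_add, mul_inv_cancel₀ (ez_ne x)]; ring
    have hl := (jac_link h0 hu hb ha2 (ez_ne x) hzx (q := fun k => (((p k).eval x : ℝ) : ℂ)) (by
      intro k
      have := congrArg (fun r : ℝ => (r : ℂ)) (hp k x)
      push_cast at this
      rw [this]
      split_ifs <;> simp
      ) k).1
    have hp0x : (p 0).eval x = (p 0).coeff 0 := by
      rw [Polynomial.eq_C_of_natDegree_eq_zero hp0]; simp
    have h1 : (conj (ez x))^k * (ez x)^k = 1 := by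
      rw [← mul_pow, mul_comm, ez_mul_conj, one_pow]
    have e : (((p 0).coeff 0 : ℝ) : ℂ) * ((conj (ez x))^k * ph u (2*k) (ez x) +
        (conj (ez x))^k * ps u (2*k) (ez x)) = ((C * (p k).eval x : ℝ) : ℂ) := by
      rw [hC]; push_cast
      rw [← hp0x]
      linear_combination (-(conj (ez x))^k) * hl + (((p k).eval x : ℝ) : ℂ) *
        (∏ i ∈ Finset.range k, (a (i+1) : ℂ)) * (1 - u (2*k)) * h1
    rw [e, Complex.ofReal_re]; ring
  exact (mul_eq_zero.mp this).resolve_left hC0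

lemma dn_integral {u : ℕ → ℝ} (hu : ∀ k : ℕ, u (k+1) ∈ Ioo (-1 : ℝ) 1) (N : ℕ) :
    ∫ x, dn u N x ∂ArcsineM = 1 := by
  have := ell_q hu (Nat.zero_le N)
  simpa [dn, kap, ps_zero] using this

lemma dn_integrable {u : ℕ → ℝ} (hu : ∀ k : ℕ, u (k+1) ∈ Ioo (-1 : ℝ) 1) (N : ℕ) {f : ℝ → ℝ}
    (hf : ContinuousOn f (Icc (-2) 2)) : Integrable (fun x => f x * dn u N x) ArcsineM :=
  cont_integrable arc_supp (hf.mul (dn_cont hu N).continuousOn)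

lemma poly_limit {μ : Measure ℝ} [IsProbabilityMeasure μ] (hsupp : μ (Icc (-2) 2)ᶜ = 0)
    {u : ℕ → ℝ} (hu' : IsCanonicalMoments μ u) (f : ℝ[X]) :
    ∀ᶠ N in atTop, ∫ x, f.eval x * dn u N x ∂ArcsineM = ∫ x, f.eval x ∂μ := by
  obtain ⟨h0, hu, a, b, ⟨ha, p, hdeg, hlead, horth, hrec⟩, hb, ha2⟩ := hu'
  have hc : ∀ q : ℝ[X], ContinuousOn (fun x => q.eval x) (Icc (-2) 2) := fun q =>
    q.continuous.continuousOn
  have hp0x : ∀ x, (p 0).eval x = (p 0).coeff 0 := fun x => by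
      rw [Polynomial.eq_C_of_natDegree_eq_zero (hdeg 0)]; simp
  have hp00 : (p 0).coeff 0 ≠ 0 := by
    have := hlead 0
    rw [Polynomial.leadingCoeff, hdeg 0] at this
    exact this.ne'
  have hP : ∀ k, ∀ᶠ N in atTop, ∫ x, (p k).eval x * dn u N x ∂ArcsineM = ∫ x, (p k).eval x ∂μ := by
    intro k
    filter_upwards [eventually_ge_atTop (2*k)] with N hN
    rcases Nat.eq_zero_or_pos k with rfl | hk
    · simp only [hp0x]
      rw [integral_const_mul, dn_integral hu]; simp
    · rw [jac_zero h0 hu hb ha2 ha (hdeg 0) hrec hk hN]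
      have := horth 0 k
      rw [if_neg (by omega)] at this
      simp only [hp0x] at this
      rw [integral_const_mul] at this
      exact ((mul_eq_zero.mp this).resolve_left hp00).symm
  have hadd : ∀ q r : ℝ[X], (∀ᶠ N in atTop, ∫ x, q.eval x * dn u N x ∂ArcsineM = ∫ x, q.eval x ∂μ) →
      (∀ᶠ N in atTop, ∫ x, r.eval x * dn u N x ∂ArcsineM = ∫ x, r.eval x ∂μ) →
      ∀ᶠ N in atTop, ∫ x, (q + r).eval x * dn u N x ∂ArcsineM = ∫ x, (q + r).eval x ∂μ := by
    intro q r h1 h2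
    filter_upwards [h1, h2] with N h1 h2
    simp only [eval_add, add_mul]
    rw [integral_add (dn_integrable hu N (hc q)) (dn_integrable hu N (hc r)),
      integral_add (cont_integrable hsupp (hc q)) (cont_integrable hsupp (hc r)), h1, h2]
  have hmul : ∀ (c : ℝ) (q : ℝ[X]), (∀ᶠ N in atTop, ∫ x, q.eval x * dn u N x ∂ArcsineM = ∫ x, q.eval x ∂μ) →
      ∀ᶠ N in atTop, ∫ x, (C c * q).eval x * dn u N x ∂ArcsineM = ∫ x, (C c * q).eval x ∂μ := by
    intro c q h1
    filter_upwards [h1] with N h1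
    simp only [eval_mul, eval_C, mul_assoc]
    rw [integral_const_mul, integral_const_mul, h1]
  have main : ∀ n : ℕ, ∀ f : ℝ[X], f.natDegree ≤ n →
      ∀ᶠ N in atTop, ∫ x, f.eval x * dn u N x ∂ArcsineM = ∫ x, f.eval x ∂μ := by
    intro n
    induction n with
    | zero =>
      intro f hf
      have : f = C (f.coeff 0 / (p 0).coeff 0) * p 0 := by
        conv_rhs => rw [Polynomial.eq_C_of_natDegree_eq_zero (hdeg 0)]
        conv_lhs => rw [Polynomial.eq_C_of_natDegree_le_zero hf]
        simp only [coeff_C_zero, ← C_mul]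
        rw [div_mul_cancel₀ _ hp00]
      rw [this]
      exact hmul _ _ (hP 0)
    | succ n ih =>
      intro f hf
      set c := f.coeff (n+1) / (p (n+1)).leadingCoeff with hcdef
      have hl := (hlead (n+1)).ne'
      have : f = (f - C c * p (n+1)) + C c * p (n+1) := by ring
      rw [this]
      refine hadd _ _ (ih _ ?_) (hmul _ _ (hP _))
      rw [Polynomial.natDegree_le_iff_coeff_eq_zero]
      intro m hm
      rw [coeff_sub, coeff_C_mul]
      rcases eq_or_lt_of_le (Nat.succ_le_of_lt hm) with h | h
      · rw [← h]
        have : (p (n+1)).coeff (n+1) = (p (n+1)).leadingCoeff := by rw [leadingCoeff, hdeg]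
        rw [this, hcdef]
        rw [div_mul_cancel₀ _ hl, sub_self]
      · rw [coeff_eq_zero_of_natDegree_lt (by omega : f.natDegree < m),
          coeff_eq_zero_of_natDegree_lt (by rw [hdeg]; omega : (p (n+1)).natDegree < m)]
        simp
  exact main _ f le_rfl

lemma cont_limit {μ : Measure ℝ} [IsProbabilityMeasure μ] (hsupp : μ (Icc (-2) 2)ᶜ = 0)
    {u : ℕ → ℝ} (hu' : IsCanonicalMoments μ u) {f : ℝ → ℝ} (hf : ContinuousOn f (Icc (-2) 2)) :
    Tendsto (fun N => ∫ x, f x * dn u N x ∂ArcsineM) atTop (𝓝 (∫ x, f x ∂μ)) := by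
  have hu := hu'.2.1
  rw [Metric.tendsto_nhds]
  intro ε hε
  obtain ⟨p, hp⟩ := exists_polynomial_near_of_continuousOn (-2) 2 f hf (ε/3) (by positivity)
  have hpc : ContinuousOn (fun x => p.eval x) (Icc (-2) 2) := p.continuous.continuousOn
  filter_upwards [poly_limit hsupp hu' p] with N hN
  have h1 : |∫ x, f x * dn u N x ∂ArcsineM - ∫ x, p.eval x * dn u N x ∂ArcsineM| ≤ ε/3 := by
    rw [← integral_sub (dn_integrable hu N hf) (dn_integrable hu N hpc)]
    rw [← Real.norm_eq_abs]
    have : ε/3 = ∫ x, ε/3 * dn u N x ∂ArcsineM := by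
      rw [integral_const_mul, dn_integral hu, mul_one]
    rw [this]
    refine norm_integral_le_of_norm_le (dn_integrable hu N continuousOn_const) ?_
    filter_upwards [ae_Icc arc_supp] with x hx
    rw [← sub_mul, norm_mul, Real.norm_of_nonneg (dn_pos hu N x).le, Real.norm_eq_abs, abs_sub_comm]
    exact mul_le_mul_of_nonneg_right (hp x hx).le (dn_pos hu N x).le
  have h2 : |∫ x, f x ∂μ - ∫ x, p.eval x ∂μ| ≤ ε/3 := by
    rw [← integral_sub (cont_integrable hsupp hf) (cont_integrable hsupp hpc)]
    rw [← Real.norm_eq_abs]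
    have : ε/3 = ∫ x, ε/3 ∂μ := by simp
    rw [this]
    refine norm_integral_le_of_norm_le (integrable_const _) ?_
    filter_upwards [ae_Icc hsupp] with x hx
    rw [Real.norm_eq_abs, abs_sub_comm]
    exact (hp x hx).le
  rw [Real.dist_eq]
  rw [hN] at h1
  rw [abs_le] at h1 h2
  rw [abs_lt]
  constructor <;> linarith [h1.1, h1.2, h2.1, h2.2]

lemma mu_q {μ : Measure ℝ} [IsProbabilityMeasure μ] (hsupp : μ (Icc (-2) 2)ᶜ = 0)
    {u : ℕ → ℝ} (hu' : IsCanonicalMoments μ u) (n : ℕ) :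
    ∫ x, (dn u n x)⁻¹ ∂μ = 1 ∧ ∫ x, x/2 * (dn u n x)⁻¹ ∂μ = -(u (n+1) * u n) := by
  have hu := hu'.2.1
  have hi : Continuous fun x => (dn u n x)⁻¹ :=
    (dn_cont hu n).inv₀ fun x => (dn_pos hu n x).ne'
  constructor
  · refine tendsto_nhds_unique (cont_limit hsupp hu' hi.continuousOn) ?_
    refine Tendsto.congr' ?_ tendsto_const_nhds
    filter_upwards [eventually_ge_atTop n] with N hN
    exact (ell_q hu hN).symm
  · refine tendsto_nhds_unique (cont_limit hsupp hu' (f := fun x => x/2 * (dn u n x)⁻¹)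
      (by fun_prop)) ?_
    refine Tendsto.congr' ?_ tendsto_const_nhds
    filter_upwards [eventually_ge_atTop (n+1)] with N hN
    exact (ell_xq hu hu'.1 hN).symm

def vg (g x : ℝ) : ℝ := 1 + g * (x/2)

lemma vg_cont (g : ℝ) : Continuous (vg g) := by unfold vg; fun_prop

lemma vg_nonneg {g : ℝ} (hg1 : -1 ≤ g) (hg0 : g ≤ 0) {x : ℝ} (hx : x ∈ Icc (-2 : ℝ) 2) : 0 ≤ vg g x := by
  unfold vg; nlinarith [hx.1, hx.2]

lemma vg_le {g : ℝ} (hg1 : -1 ≤ g) (hg0 : g ≤ 0) {x : ℝ} (hx : x ∈ Icc (-2 : ℝ) 2) : vg g x ≤ 2 := by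
  unfold vg; nlinarith [hx.1, hx.2]

lemma mug_eq {g : ℝ} (hg1 : -1 ≤ g) (hg0 : g ≤ 0) :
    mugMix g = ArcsineM.withDensity fun x => ENNReal.ofReal (vg g x) := by
  unfold mugMix Dhard ArcsineM
  have m1 : Measurable fun x : ℝ => ENNReal.ofReal (Real.sqrt ((2 - x)/(2 + x)) / (2*π)) := by fun_prop
  have m2 : Measurable fun x : ℝ => ENNReal.ofReal (1 / (π * Real.sqrt (4 - x^2))) := by fun_prop
  rw [← withDensity_mul _ m2 (by unfold vg; fun_prop), ← withDensity_smul _ m1, ← withDensity_smul _ m2,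
    ← withDensity_add_left (m1.const_smul _)]
  congr 1
  funext x
  simp only [Pi.add_apply, Pi.smul_apply, Pi.mul_apply, smul_eq_mul]
  rw [abs_of_nonpos hg0]
  have hpi := Real.pi_pos
  rw [← ENNReal.ofReal_mul (by linarith), ← ENNReal.ofReal_mul (by linarith),
    ← ENNReal.ofReal_mul (by positivity), ← ENNReal.ofReal_add (mul_nonneg (by linarith) (by positivity))
      (mul_nonneg (by linarith) (by positivity))]
  congr 1
  have key : Real.sqrt ((2 - x)/(2 + x)) / (2*π) = (1 - x/2) * (1 / (π * Real.sqrt (4 - x^2))) := by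
    by_cases h : 0 < 4 - x^2
    · have h2 : 0 < 2 - x := by nlinarith
      have h3 : 0 < 2 + x := by nlinarith
      have : (2 - x)/(2 + x) = (2-x)^2 / (4 - x^2) := by
        field_simp; ring
      rw [this, Real.sqrt_div (by positivity), Real.sqrt_sq h2.le]
      have := Real.sqrt_pos.mpr h
      field_simp
    · rw [Real.sqrt_eq_zero_of_nonpos (by linarith : 4 - x^2 ≤ 0)]
      have : (2 - x)/(2 + x) ≤ 0 := by
        rcases le_or_gt (2+x) 0 with h' | h'
        · exact div_nonpos_of_nonneg_of_nonpos (by linarith) h'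
        · exact div_nonpos_of_nonpos_of_nonneg (by nlinarith) h'.le
      rw [Real.sqrt_eq_zero_of_nonpos this]; simp
  rw [key]
  unfold vg
  ring

lemma mug_supp {g : ℝ} (hg1 : -1 ≤ g) (hg0 : g ≤ 0) : mugMix g (Icc (-2) 2)ᶜ = 0 := by
  rw [mug_eq hg1 hg0]
  exact withDensity_absolutelyContinuous _ _ arc_supp

lemma mug_integral {g : ℝ} (hg1 : -1 ≤ g) (hg0 : g ≤ 0) (f : ℝ → ℝ) :
    ∫ x, f x ∂(mugMix g) = ∫ x, vg g x * f x ∂ArcsineM := by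
  rw [mug_eq hg1 hg0, integral_withDensity_eq_integral_toReal_smul (by unfold vg; fun_prop)
    (ae_of_all _ fun x => ENNReal.ofReal_lt_top)]
  refine integral_congr_ae ?_
  filter_upwards [ae_Icc arc_supp] with x hx
  rw [ENNReal.toReal_ofReal (vg_nonneg hg1 hg0 hx), smul_eq_mul]

lemma arc_x : ∫ x, x ∂ArcsineM = 0 := by
  have := arc_mean (G := fun z => z) (differentiable_id.diffContOnCl) (fun z _ => by simp)
  have h2 : ∫ x, x ∂ArcsineM = ∫ x, 2 * (ez x).re ∂ArcsineM := by
    refine integral_congr_ae ?_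
    filter_upwards [ae_Icc arc_supp] with x hx
    rw [ez_re hx]; ring
  rw [h2, integral_const_mul, this]; simp

lemma vg_int (g : ℝ) : ∫ x, vg g x ∂ArcsineM = 1 := by
  unfold vg
  have : Integrable (fun x : ℝ => g * (x/2)) ArcsineM :=
    cont_integrable arc_supp (by fun_prop)
  rw [integral_add (integrable_const _) this, integral_const_mul, integral_div, arc_x]
  simp

lemma mug_prob {g : ℝ} (hg1 : -1 ≤ g) (hg0 : g ≤ 0) : IsProbabilityMeasure (mugMix g) := by
  constructor
  rw [mug_eq hg1 hg0, withDensity_apply _ MeasurableSet.univ, Measure.restrict_univ,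
    ← ofReal_integral_eq_lintegral_ofReal, vg_int]
  · simp
  · exact cont_integrable arc_supp (vg_cont g).continuousOn
  · filter_upwards [ae_Icc arc_supp] with x hx
    exact vg_nonneg hg1 hg0 hx

lemma v_log_dn {u : ℕ → ℝ} (h0 : u 0 = -1) (hu : ∀ k : ℕ, u (k+1) ∈ Ioo (-1 : ℝ) 1) (g : ℝ) (n : ℕ) :
    ∫ x, vg g x * Real.log (dn u n x) ∂ArcsineM =
      ∑ k ∈ Finset.range n, Real.log (1 - u (k+1)^2) - g * ∑ k ∈ Finset.range n, u (k+1) * u k := by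
  obtain ⟨i1, i2⟩ := arc_log (ps_differentiable u n) (fun z hz => (sz_norm u hu n z hz).2)
    (ps_at_zero u n) (ps_conj u n)
  rw [(ps_deriv_zero u h0 n).deriv, Complex.ofReal_re] at i2
  have hc : Continuous fun x => Real.log (‖ps u n (ez x)‖^2) := by
    refine Continuous.log ((ps_ez_cont u n).norm.pow 2) fun x => ?_
    have := norm_pos_iff.mpr (ps_ez_ne hu n x)
    positivity
  have e : ∀ x, vg g x * Real.log (dn u n x) = vg g x * Real.log (kap u n)
      - (Real.log (‖ps u n (ez x)‖^2) + g * (x/2 * Real.log (‖ps u n (ez x)‖^2))) := by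
    intro x
    have := norm_pos_iff.mpr (ps_ez_ne hu n x)
    unfold dn
    rw [Real.log_div (kap_pos hu n).ne' (by positivity)]
    unfold vg; ring
  simp only [e]
  have I1 : Integrable (fun x => vg g x * Real.log (kap u n)) ArcsineM :=
    cont_integrable arc_supp ((vg_cont g).mul continuous_const).continuousOn
  have I2 : Integrable (fun x => Real.log (‖ps u n (ez x)‖^2)) ArcsineM :=
    cont_integrable arc_supp hc.continuousOn
  have I3 : Integrable (fun x => g * (x/2 * Real.log (‖ps u n (ez x)‖^2))) ArcsineM :=
    cont_integrable arc_supp (Continuous.continuousOn (by fun_prop))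
  have I23 : Integrable (fun x => Real.log (‖ps u n (ez x)‖^2) +
      g * (x/2 * Real.log (‖ps u n (ez x)‖^2))) ArcsineM := I2.add I3
  rw [integral_sub I1 I23, integral_add I2 I3, integral_mul_const, vg_int,
    integral_const_mul, i1, i2]
  unfold kap
  rw [Real.log_prod (fun k _ => (one_sub_sq_pos hu k).ne')]
  ring

lemma v_log_v_aux {g : ℝ} (hg1 : -1 < g) (hg0 : g ≤ 0) :
    ∫ x, vg g x * Real.log (vg g x) ∂ArcsineM = Hgw g := by
  set s := Real.sqrt (1 - g^2) with hs
  have hs0 : 0 < s := Real.sqrt_pos.mpr (by nlinarith)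
  have hs2 : s^2 = 1 - g^2 := Real.sq_sqrt (by nlinarith)
  set r := -g/(1+s) with hr
  have hr0 : 0 ≤ r := div_nonneg (by linarith) (by linarith)
  have hr1 : r < 1 := by
    rw [hr, div_lt_one (by linarith)]; linarith
  have hr2 : 1 + r^2 = 2/(1+s) := by
    rw [hr]; field_simp; nlinarith
  have hgr : -2*r = g * (1 + r^2) := by rw [hr2, hr]; field_simp
  have hne : ∀ z : ℂ, ‖z‖ ≤ 1 → 1 - (r:ℂ) * z ≠ 0 := by
    intro z hz h
    have : (r:ℂ) * z = 1 := by linear_combination -h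
    have h2 := congrArg norm this
    rw [norm_mul, Complex.norm_real, norm_one, Real.norm_of_nonneg hr0] at h2
    nlinarith [norm_nonneg z]
  obtain ⟨i1, i2⟩ := arc_log (P := fun z => 1 - (r:ℂ) * z) (by fun_prop) hne (by simp) (by simp)
  have hd : deriv (fun z : ℂ => 1 - (r:ℂ) * z) 0 = -(r:ℂ) := by
    have : HasDerivAt (fun z : ℂ => 1 - (r:ℂ) * z) (0 - (r:ℂ) * 1) 0 :=
      (hasDerivAt_const _ _).sub ((hasDerivAt_id _).const_mul _)
    rw [this.deriv]; ring
  rw [hd] at i2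
  have hpos : ∀ x, 0 < ‖1 - (r:ℂ) * ez x‖ := fun x => norm_pos_iff.mpr (hne _ (ez_norm x).le)
  have hc : Continuous fun x => Real.log (‖1 - (r:ℂ) * ez x‖^2) := by
    have := ez_cont
    refine Continuous.log (by fun_prop) fun x => ?_
    have := hpos x
    positivity
  have hv : ∀ x ∈ Icc (-2 : ℝ) 2, vg g x = ‖1 - (r:ℂ) * ez x‖^2 / (1 + r^2) := by
    intro x hx
    have h1 : ‖1 - (r:ℂ) * ez x‖^2 = 1 + r^2 - 2 * r * (x/2) := by
      have hn : (ez x).re^2 + (ez x).im^2 = 1 := by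
        have := Complex.normSq_eq_norm_sq (ez x)
        rw [ez_norm, Complex.normSq_apply] at this
        nlinarith
      rw [← Complex.normSq_eq_norm_sq, Complex.normSq_apply, ← ez_re hx]
      simp
      nlinarith
    rw [h1, eq_div_iff (by positivity)]
    unfold vg
    linear_combination (-(x/2)) * hgr
  have e : ∀ x ∈ Icc (-2 : ℝ) 2, vg g x * Real.log (vg g x) = (Real.log (‖1 - (r:ℂ) * ez x‖^2) +
      g * (x/2 * Real.log (‖1 - (r:ℂ) * ez x‖^2))) - vg g x * Real.log (1 + r^2) := by
    intro x hx
    have := hpos x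
    have h1 : Real.log (vg g x) = Real.log (‖1 - (r:ℂ) * ez x‖^2) - Real.log (1 + r^2) := by
      rw [hv x hx, Real.log_div (by positivity) (by positivity)]
    rw [h1]; unfold vg; ring
  have I1 : Integrable (fun x => vg g x * Real.log (1 + r^2)) ArcsineM :=
    cont_integrable arc_supp ((vg_cont g).mul continuous_const).continuousOn
  have I2 : Integrable (fun x => Real.log (‖1 - (r:ℂ) * ez x‖^2)) ArcsineM :=
    cont_integrable arc_supp hc.continuousOn
  have I3 : Integrable (fun x => g * (x/2 * Real.log (‖1 - (r:ℂ) * ez x‖^2))) ArcsineM :=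
    cont_integrable arc_supp (Continuous.continuousOn (by fun_prop))
  have I23 : Integrable (fun x => Real.log (‖1 - (r:ℂ) * ez x‖^2) +
      g * (x/2 * Real.log (‖1 - (r:ℂ) * ez x‖^2))) ArcsineM := I2.add I3
  rw [integral_congr_ae (g := fun x => (Real.log (‖1 - (r:ℂ) * ez x‖^2) +
      g * (x/2 * Real.log (‖1 - (r:ℂ) * ez x‖^2))) - vg g x * Real.log (1 + r^2))
      (by filter_upwards [ae_Icc arc_supp] with x hx using e x hx),
    integral_sub I23 I1, integral_add I2 I3, integral_mul_const, vg_int,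
    integral_const_mul, i1, i2]
  unfold Hgw
  rw [← hs, hr2]
  have h3 : Real.log (2/(1+s)) = - Real.log ((1+s)/2) := by
    rw [← Real.log_inv, inv_div]
  rw [h3]
  simp only [Complex.neg_re, Complex.ofReal_re]
  have : 1 - s = -g * r := by
    rw [hr]; field_simp; nlinarith
  linarith

lemma hgw_cont : Continuous Hgw := by
  unfold Hgw
  refine Continuous.add (by fun_prop) (Continuous.log (by fun_prop) fun g => ?_)
  positivity

lemma v_log_v {g : ℝ} (hg1 : -1 ≤ g) (hg0 : g ≤ 0) :
    ∫ x, vg g x * Real.log (vg g x) ∂ArcsineM = Hgw g := by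
  rcases eq_or_lt_of_le hg1 with h | h
  swap
  · exact v_log_v_aux h hg0
  subst h
  set gs : ℕ → ℝ := fun n => -1 + 1/((n:ℝ)+1) with hgs
  have hlim : Tendsto gs atTop (𝓝 (-1)) := by
    have := (tendsto_one_div_add_atTop_nhds_zero_nat (𝕜 := ℝ)).const_add (-1)
    simpa [hgs] using this
  have hb : ∀ n, -1 < gs n ∧ gs n ≤ 0 := by
    intro n
    have h1 : 0 < 1/((n:ℝ)+1) := by positivity
    have h2 : 1/((n:ℝ)+1) ≤ 1 := by
      rw [div_le_one (by positivity)]; linarith [(Nat.cast_nonneg n : (0:ℝ) ≤ n)]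
    simp only [hgs]
    constructor <;> linarith
  obtain ⟨C, hC⟩ := (isCompact_Icc (a := (0:ℝ)) (b := 2)).exists_bound_of_continuousOn
    Real.continuous_mul_log.continuousOn
  have h1 : Tendsto (fun n => ∫ x, vg (gs n) x * Real.log (vg (gs n) x) ∂ArcsineM) atTop
      (𝓝 (∫ x, vg (-1) x * Real.log (vg (-1) x) ∂ArcsineM)) := by
    refine tendsto_integral_of_dominated_convergence (fun _ => C) ?_ (integrable_const C) ?_ ?_
    · intro n
      exact (Real.continuous_mul_log.comp (vg_cont (gs n))).aestronglyMeasurable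
    · intro n
      filter_upwards [ae_Icc arc_supp] with x hx
      exact hC _ ⟨vg_nonneg (hb n).1.le (hb n).2 hx, vg_le (hb n).1.le (hb n).2 hx⟩
    · refine ae_of_all _ fun x => ?_
      have : Continuous fun g => vg g x := by unfold vg; fun_prop
      exact ((Real.continuous_mul_log.comp this).tendsto (-1)).comp hlim
  refine tendsto_nhds_unique h1 ?_
  refine Tendsto.congr (fun n => (v_log_v_aux (hb n).1 (hb n).2).symm) ?_
  exact (hgw_cont.tendsto (-1)).comp hlim

lemma hgw_le {g : ℝ} (hg1 : -1 ≤ g) (hg0 : g ≤ 0) : Hgw g + g/2 ≤ 0 := by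
  unfold Hgw
  set s := Real.sqrt (1 - g^2) with hs
  have hs0 : 0 ≤ s := Real.sqrt_nonneg _
  have hs2 : s^2 = 1 - g^2 := Real.sq_sqrt (by nlinarith)
  have h1 := Real.log_le_sub_one_of_pos (show 0 < (1+s)/2 by positivity)
  have h2 : 1 + g ≤ s := by nlinarith
  linarith

def Jn (g : ℝ) (u : ℕ → ℝ) (n : ℕ) : ℝ :=
  Hgw g + g * ∑ k ∈ Finset.range n, u (k+1) * u k - ∑ k ∈ Finset.range n, Real.log (1 - u (k+1)^2)

lemma mug_integrable {g : ℝ} (hg1 : -1 ≤ g) (hg0 : g ≤ 0) {f : ℝ → ℝ}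
    (hf : Integrable (fun x => vg g x * f x) ArcsineM) : Integrable f (mugMix g) := by
  rw [mug_eq hg1 hg0, integrable_withDensity_iff_integrable_smul' (by unfold vg; fun_prop)
    (ae_of_all _ fun x => ENNReal.ofReal_lt_top)]
  refine hf.congr ?_
  filter_upwards [ae_Icc arc_supp] with x hx
  rw [ENNReal.toReal_ofReal (vg_nonneg hg1 hg0 hx), smul_eq_mul]

lemma vlogv_integrable (g : ℝ) : Integrable (fun x => vg g x * Real.log (vg g x)) ArcsineM :=
  cont_integrable arc_supp (Real.continuous_mul_log.comp (vg_cont g)).continuousOn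

lemma log_dn_cont {u : ℕ → ℝ} (hu : ∀ k : ℕ, u (k+1) ∈ Ioo (-1 : ℝ) 1) (n : ℕ) :
    Continuous fun x => Real.log (dn u n x) := (dn_cont hu n).log fun x => (dn_pos hu n x).ne'

lemma vlogdn_integrable {u : ℕ → ℝ} (hu : ∀ k : ℕ, u (k+1) ∈ Ioo (-1 : ℝ) 1) (g : ℝ) (n : ℕ) :
    Integrable (fun x => vg g x * Real.log (dn u n x)) ArcsineM :=
  cont_integrable arc_supp ((vg_cont g).mul (log_dn_cont hu n)).continuousOn

lemma Jn_eq {g : ℝ} (hg1 : -1 ≤ g) (hg0 : g ≤ 0) {u : ℕ → ℝ} (h0 : u 0 = -1)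
    (hu : ∀ k : ℕ, u (k+1) ∈ Ioo (-1 : ℝ) 1) (n : ℕ) :
    Integrable (fun x => Real.log (vg g x) - Real.log (dn u n x)) (mugMix g) ∧
    ∫ x, (Real.log (vg g x) - Real.log (dn u n x)) ∂(mugMix g) = Jn g u n := by
  constructor
  · refine mug_integrable hg1 hg0 ?_
    simp only [mul_sub]
    exact (vlogv_integrable g).sub (vlogdn_integrable hu g n)
  · rw [mug_integral hg1 hg0]
    simp only [mul_sub]
    rw [integral_sub (vlogv_integrable g) (vlogdn_integrable hu g n), v_log_v hg1 hg0,
      v_log_dn h0 hu]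
    unfold Jn; ring

lemma mug_v_pos {g : ℝ} (hg1 : -1 ≤ g) (hg0 : g ≤ 0) : ∀ᵐ x ∂(mugMix g), 0 < vg g x := by
  rw [mug_eq hg1 hg0, ae_withDensity_iff (by unfold vg; fun_prop)]
  refine ae_of_all _ fun x hx => ?_
  simpa using hx

def cn (g : ℝ) (u : ℕ → ℝ) (n : ℕ) : ℝ := 1 - g * (u (n+1) * u n)

lemma u_abs {u : ℕ → ℝ} (h0 : u 0 = -1) (hu : ∀ k : ℕ, u (k+1) ∈ Ioo (-1 : ℝ) 1) (n : ℕ) :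
    |u n| ≤ 1 := by
  cases n with
  | zero => rw [h0]; simp
  | succ n => rw [abs_le]; exact ⟨(hu n).1.le, (hu n).2.le⟩

lemma cn_bd {g : ℝ} (hg1 : -1 ≤ g) (hg0 : g ≤ 0) {u : ℕ → ℝ} (h0 : u 0 = -1)
    (hu : ∀ k : ℕ, u (k+1) ∈ Ioo (-1 : ℝ) 1) (n : ℕ) : 0 < cn g u n ∧ cn g u n ≤ 2 := by
  have h1 : |u (n+1)| < 1 := abs_lt.mpr (hu n)
  have h2 := u_abs h0 hu n
  have h3 : |g * (u (n+1) * u n)| < 1 := by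
    rw [abs_mul, abs_mul]
    have hg : |g| ≤ 1 := by rw [abs_le]; constructor <;> linarith
    have : |u (n+1)| * |u n| < 1 := by nlinarith [abs_nonneg (u n), abs_nonneg (u (n+1))]
    nlinarith [abs_nonneg g, mul_nonneg (abs_nonneg (u (n+1))) (abs_nonneg (u n))]
  rw [abs_lt] at h3
  unfold cn
  constructor <;> linarith [h3.1, h3.2]

lemma mu_h {μ : Measure ℝ} [IsProbabilityMeasure μ] (hsupp : μ (Icc (-2) 2)ᶜ = 0)
    {u : ℕ → ℝ} (hu' : IsCanonicalMoments μ u) (g : ℝ) (n : ℕ) :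
    Integrable (fun x => vg g x * (dn u n x)⁻¹) μ ∧
    ∫ x, vg g x * (dn u n x)⁻¹ ∂μ = cn g u n := by
  have hu := hu'.2.1
  have hi : Continuous fun x => (dn u n x)⁻¹ :=
    (dn_cont hu n).inv₀ fun x => (dn_pos hu n x).ne'
  refine ⟨cont_integrable hsupp ((vg_cont g).mul hi).continuousOn, ?_⟩
  obtain ⟨h1, h2⟩ := mu_q hsupp hu' n
  have e : ∀ x, vg g x * (dn u n x)⁻¹ = (dn u n x)⁻¹ + g * (x/2 * (dn u n x)⁻¹) := by
    intro x; unfold vg; ring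
  simp only [e]
  have i2 : Integrable (fun x => g * (x/2 * (dn u n x)⁻¹)) μ :=
    cont_integrable hsupp (Continuous.continuousOn (by fun_prop))
  rw [integral_add (cont_integrable hsupp hi.continuousOn) i2, integral_const_mul, h1, h2]
  unfold cn; ring

lemma lower_bd {g : ℝ} (hg1 : -1 ≤ g) (hg0 : g ≤ 0)
    {μ : Measure ℝ} [IsProbabilityMeasure μ] (hsupp : μ (Icc (-2) 2)ᶜ = 0)
    {u : ℕ → ℝ} (hu' : IsCanonicalMoments μ u) (hac : mugMix g ≪ μ)
    (hint : Integrable (llr (mugMix g) μ) (mugMix g)) (n : ℕ) :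
    Jn g u n - Real.log (cn g u n) ≤ ∫ x, llr (mugMix g) μ x ∂(mugMix g) := by
  have hu := hu'.2.1
  have := mug_prob hg1 hg0
  set ν := mugMix g with hν
  obtain ⟨iL, eL⟩ := Jn_eq hg1 hg0 hu'.1 hu n
  obtain ⟨ih, eh⟩ := mu_h hsupp hu' g n
  have hc := (cn_bd hg1 hg0 hu'.1 hu n).1
  set c := cn g u n with hcdef
  set h : ℝ → ℝ := fun x => vg g x * (dn u n x)⁻¹ with hh
  set r : ℝ → ℝ := fun x => (ν.rnDeriv μ x).toReal with hr
  have hrm : Measurable r := (Measure.measurable_rnDeriv _ _).ennreal_toReal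
  have hhm : Measurable h := by
    have := (dn_cont hu n).measurable
    have := (vg_cont g).measurable
    fun_prop
  have hle : ∀ᵐ x ∂μ, 0 ≤ r x • (h x / r x) ∧ r x • (h x / r x) ≤ h x := by
    filter_upwards [ae_Icc hsupp] with x hx
    have hx0 : 0 ≤ h x := mul_nonneg (vg_nonneg hg1 hg0 hx) (inv_nonneg.mpr (dn_pos hu n x).le)
    rw [smul_eq_mul]
    by_cases hrx : r x = 0
    · rw [hrx]; simpa using hx0
    · rw [mul_div_cancel₀ _ hrx]; exact ⟨hx0, le_rfl⟩
  have i1 : Integrable (fun x => r x • (h x / r x)) μ := by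
    refine ih.mono' (by fun_prop) ?_
    filter_upwards [hle] with x hx
    rw [Real.norm_of_nonneg hx.1]; exact hx.2
  have i2 : Integrable (fun x => h x / r x) ν := (integrable_rnDeriv_smul_iff hac).mp i1
  have e2 : ∫ x, h x / r x ∂ν ≤ c := by
    rw [← integral_rnDeriv_smul hac, ← eh]
    refine integral_mono_ae i1 ih ?_
    filter_upwards [hle] with x hx using hx.2
  have key : ∀ᵐ x ∂ν, (Real.log (vg g x) - Real.log (dn u n x)) - llr ν μ x ≤
      (h x / r x) * c⁻¹ + (Real.log c - 1) := by
    filter_upwards [mug_v_pos hg1 hg0, Measure.rnDeriv_pos hac,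
      hac.ae_le (Measure.rnDeriv_lt_top ν μ)] with x hv hr1 hr2
    have hrx : 0 < r x := ENNReal.toReal_pos hr1.ne' hr2.ne
    have hd := dn_pos hu n x
    have hhx : 0 < h x := mul_pos hv (inv_pos.mpr hd)
    have := Real.log_le_sub_one_of_pos (show 0 < h x / r x * c⁻¹ by positivity)
    rw [Real.log_mul (by positivity) (by positivity), Real.log_div hhx.ne' hrx.ne', Real.log_inv,
      hh] at this
    simp only at this
    rw [Real.log_mul hv.ne' (by positivity), Real.log_inv] at this
    unfold llr
    change _ - Real.log (r x) ≤ _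
    linarith
  have h3 := integral_mono_ae (iL.sub hint) ((i2.mul_const c⁻¹).add (integrable_const _)) key
  simp only [Pi.sub_apply, Pi.add_apply] at h3
  rw [integral_sub iL hint, eL] at h3
  rw [integral_add (i2.mul_const c⁻¹) (integrable_const _), integral_mul_const] at h3
  simp only [integral_const, probReal_univ, one_smul] at h3
  have h4 : (∫ x, h x / r x ∂ν) * c⁻¹ ≤ 1 := by
    rw [← div_eq_mul_inv, div_le_one hc]; exact e2
  linarith

lemma ent_pt {v d c : ℝ} (hv : 0 ≤ v) (hd : 0 < d) (hc0 : 0 < c) (f : ℝ) :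
    v * f ≤ ((v * Real.log v - v * Real.log d) + (Real.exp f * d) * c⁻¹) + v * (Real.log c - 1) := by
  rcases eq_or_lt_of_le hv with hv | hv
  · have : 0 < Real.exp f * d * c⁻¹ := by positivity
    rw [← hv]; linarith
  · have hy : 0 < Real.exp f * d * c⁻¹ / v := by positivity
    have h1 := Real.log_le_sub_one_of_pos hy
    rw [Real.log_div (by positivity) hv.ne', Real.log_mul (by positivity) (by positivity),
      Real.log_mul (by positivity) hd.ne', Real.log_exp, Real.log_inv] at h1
    have h2 := mul_le_mul_of_nonneg_left h1 hv.le
    have h3 : v * (Real.exp f * d * c⁻¹ / v - 1) = Real.exp f * d * c⁻¹ - v := by field_simp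
    rw [h3] at h2
    linarith

/-- entropy inequality for the approximants -/
lemma upper_bd {g : ℝ} (hg1 : -1 ≤ g) (hg0 : g ≤ 0)
    {u : ℕ → ℝ} (h0 : u 0 = -1) (hu : ∀ k : ℕ, u (k+1) ∈ Ioo (-1 : ℝ) 1) {f : ℝ → ℝ}
    (hf : Continuous f) (n : ℕ) :
    ∫ x, f x ∂(mugMix g) ≤ Jn g u n + Real.log (∫ x, Real.exp (f x) * dn u n x ∂ArcsineM) := by
  obtain ⟨iL, eL⟩ := Jn_eq hg1 hg0 h0 hu n
  have := mug_prob hg1 hg0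
  have hfc : Continuous fun x => Real.exp (f x) * dn u n x :=
    (Real.continuous_exp.comp hf).mul (dn_cont hu n)
  have ie : Integrable (fun x => Real.exp (f x) * dn u n x) ArcsineM :=
    cont_integrable arc_supp hfc.continuousOn
  set c := ∫ x, Real.exp (f x) * dn u n x ∂ArcsineM with hc
  have hc0 : 0 < c := by
    rw [hc, integral_pos_iff_support_of_nonneg]
    · have : Function.support (fun x => Real.exp (f x) * dn u n x) = univ := by
        ext x
        simp [(dn_pos hu n x).ne', Real.exp_ne_zero]
      rw [this]; simp
    · intro x
      exact (mul_pos (Real.exp_pos _) (dn_pos hu n x)).le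
    · exact ie
  have iF : Integrable (fun x => vg g x * f x) ArcsineM :=
    cont_integrable arc_supp ((vg_cont g).mul hf).continuousOn
  have iv : Integrable (fun x => vg g x * (Real.log c - 1)) ArcsineM :=
    cont_integrable arc_supp ((vg_cont g).mul continuous_const).continuousOn
  have key : ∀ᵐ x ∂ArcsineM, vg g x * f x ≤
      ((vg g x * Real.log (vg g x) - vg g x * Real.log (dn u n x)) +
        (Real.exp (f x) * dn u n x) * c⁻¹) + vg g x * (Real.log c - 1) := by
    filter_upwards [ae_Icc arc_supp] with x hx
    have hd := dn_pos hu n x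
    exact ent_pt (vg_nonneg hg1 hg0 hx) hd hc0 (f x)
  have iD : Integrable (fun x => vg g x * Real.log (vg g x) - vg g x * Real.log (dn u n x)) ArcsineM :=
    (vlogv_integrable g).sub (vlogdn_integrable hu g n)
  have iE : Integrable (fun x => (vg g x * Real.log (vg g x) - vg g x * Real.log (dn u n x)) +
        (Real.exp (f x) * dn u n x) * c⁻¹) ArcsineM := iD.add (ie.mul_const _)
  have h3 := integral_mono_ae iF (iE.add iv) key
  simp only [Pi.add_apply] at h3
  rw [integral_add iE iv, integral_add iD (ie.mul_const _), integral_mul_const, integral_mul_const,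
    vg_int, ← hc, mul_inv_cancel₀ hc0.ne'] at h3
  rw [mug_integral hg1 hg0] at eL ⊢
  simp only [mul_sub] at eL h3
  rw [eL] at h3
  linarith

lemma exp_lip {M a b : ℝ} (ha : a ≤ M) (hb : b ≤ M) :
    |Real.exp a - Real.exp b| ≤ Real.exp M * |a - b| := by
  wlog h : b ≤ a generalizing a b
  · rw [abs_sub_comm, abs_sub_comm a b]; exact this hb ha (by linarith)
  rw [abs_of_nonneg (by simpa using h), abs_of_nonneg (by linarith)]
  have h1 := Real.add_one_le_exp (b - a)
  have h2 : Real.exp b = Real.exp a * Real.exp (b - a) := by rw [← Real.exp_add]; congr 1; ring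
  have h3 : Real.exp a ≤ Real.exp M := Real.exp_le_exp.mpr ha
  have h4 := Real.exp_pos a
  rw [h2]
  nlinarith

def clampR (M x : ℝ) : ℝ := max (-M) (min x M)

lemma clampR_cont (M : ℝ) : Continuous (clampR M) := by unfold clampR; fun_prop

lemma clampR_abs {M : ℝ} (hM : 0 ≤ M) (x : ℝ) : |clampR M x| ≤ M := by
  unfold clampR
  rw [abs_le]
  exact ⟨le_max_left _ _, max_le (by linarith) (min_le_right _ _)⟩

lemma clampR_self {M x : ℝ} (h : |x| ≤ M) : clampR M x = x := by
  unfold clampR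
  rw [abs_le] at h
  rw [min_eq_left h.2, max_eq_right h.1]

lemma clampR_lip (M x y : ℝ) : |clampR M x - clampR M y| ≤ |x - y| := by
  unfold clampR
  refine (abs_max_sub_max_le_max _ _ _ _).trans ?_
  rw [sub_self, abs_zero]
  refine max_le (abs_nonneg _) ((abs_min_sub_min_le_max _ _ _ _).trans ?_)
  simp

lemma dv_meas {μ ν : Measure ℝ} [IsProbabilityMeasure μ] [IsProbabilityMeasure ν] {J : ℝ}
    (hJ : ∀ f : ℝ → ℝ, Continuous f → (∃ M, ∀ x, |f x| ≤ M) →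
      ∫ x, f x ∂ν ≤ J + Real.log (∫ x, Real.exp (f x) ∂μ))
    {f : ℝ → ℝ} (hf : Measurable f) {M : ℝ} (hM : ∀ x, |f x| ≤ M) :
    ∫ x, f x ∂ν ≤ J + Real.log (∫ x, Real.exp (f x) ∂μ) := by
  have hM0 : 0 ≤ M := (abs_nonneg _).trans (hM 0)
  have hint : ∀ (m : Measure ℝ) [IsFiniteMeasure m] (F : ℝ → ℝ), Measurable F →
      (∀ x, |F x| ≤ M) → Integrable F m := by
    intro m _ F hF hb
    exact Integrable.of_bound hF.aestronglyMeasurable M (ae_of_all _ hb)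
  have hinte : ∀ (m : Measure ℝ) [IsFiniteMeasure m] (F : ℝ → ℝ), Measurable F →
      (∀ x, |F x| ≤ M) → Integrable (fun x => Real.exp (F x)) m := by
    intro m _ F hF hb
    refine Integrable.of_bound hF.exp.aestronglyMeasurable (Real.exp M) (ae_of_all _ fun x => ?_)
    rw [Real.norm_of_nonneg (Real.exp_pos _).le]
    exact Real.exp_le_exp.mpr (abs_le.mp (hb x)).2
  have hseq : ∀ n : ℕ, ∃ q : ℝ → ℝ, Continuous q ∧ (∀ x, |q x| ≤ M) ∧
      |∫ x, q x ∂ν - ∫ x, f x ∂ν| ≤ 1/((n:ℝ)+1) ∧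
      |∫ x, Real.exp (q x) ∂μ - ∫ x, Real.exp (f x) ∂μ| ≤ Real.exp M * (1/((n:ℝ)+1)) := by
    intro n
    obtain ⟨q, hq1, hq2⟩ := (hint (μ + ν) f hf hM).exists_boundedContinuous_integral_sub_le
      (show 0 < 1/((n:ℝ)+1) by positivity)
    have hqc : Continuous fun x => clampR M (q x) := (clampR_cont M).comp q.continuous
    have hqb : ∀ x, |clampR M (q x)| ≤ M := fun x => clampR_abs hM0 _
    have hni : Integrable (fun x => ‖f x - q x‖) (μ + ν) := ((hint (μ + ν) f hf hM).sub hq2).norm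
    have hμi : Integrable (fun x => ‖f x - q x‖) μ := hni.left_of_add_measure
    have hνi : Integrable (fun x => ‖f x - q x‖) ν := hni.right_of_add_measure
    rw [integral_add_measure hμi hνi] at hq1
    have n1 : 0 ≤ ∫ x, ‖f x - q x‖ ∂μ := integral_nonneg fun x => norm_nonneg _
    have n2 : 0 ≤ ∫ x, ‖f x - q x‖ ∂ν := integral_nonneg fun x => norm_nonneg _
    have hpt : ∀ x, |clampR M (q x) - f x| ≤ ‖f x - q x‖ := by
      intro x
      have := clampR_lip M (q x) (f x)
      rw [clampR_self (hM x)] at this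
      rwa [Real.norm_eq_abs, abs_sub_comm (f x)]
    refine ⟨_, hqc, hqb, ?_, ?_⟩
    · rw [← integral_sub (hint ν _ hqc.measurable hqb) (hint ν _ hf hM), ← Real.norm_eq_abs]
      refine (norm_integral_le_of_norm_le hνi (ae_of_all _ fun x => hpt x)).trans (by linarith)
    · rw [← integral_sub (hinte μ _ hqc.measurable hqb) (hinte μ _ hf hM), ← Real.norm_eq_abs]
      refine (norm_integral_le_of_norm_le (hμi.const_mul (Real.exp M)) (ae_of_all _ fun x => ?_)).trans ?_
      · exact (exp_lip (abs_le.mp (hqb x)).2 (abs_le.mp (hM x)).2).trans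
          (mul_le_mul_of_nonneg_left (hpt x) (Real.exp_pos M).le)
      · rw [integral_const_mul]
        exact mul_le_mul_of_nonneg_left (by linarith) (Real.exp_pos M).le
  choose q hqc hqb h1 h2 using hseq
  have hz : Tendsto (fun n : ℕ => 1/((n:ℝ)+1)) atTop (𝓝 0) := tendsto_one_div_add_atTop_nhds_zero_nat
  have t1 : Tendsto (fun n => ∫ x, q n x ∂ν) atTop (𝓝 (∫ x, f x ∂ν)) := by
    rw [tendsto_iff_dist_tendsto_zero]
    exact squeeze_zero (fun n => dist_nonneg) (fun n => by rw [Real.dist_eq]; exact h1 n) hz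
  have t2 : Tendsto (fun n => ∫ x, Real.exp (q n x) ∂μ) atTop (𝓝 (∫ x, Real.exp (f x) ∂μ)) := by
    rw [tendsto_iff_dist_tendsto_zero]
    refine squeeze_zero (g := fun n : ℕ => Real.exp M * (1/((n:ℝ)+1))) (fun n => dist_nonneg)
      (fun n => by rw [Real.dist_eq]; exact h2 n) ?_
    simpa using hz.const_mul (Real.exp M)
  have hpos : 0 < ∫ x, Real.exp (f x) ∂μ := integral_exp_pos (hinte μ f hf hM)
  refine le_of_tendsto_of_tendsto' t1 ((t2.log hpos.ne').const_add J) fun n => ?_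
  exact hJ _ (hqc n) ⟨M, hqb n⟩

lemma rev_dv {μ ν : Measure ℝ} [IsProbabilityMeasure μ] [IsProbabilityMeasure ν] {J : ℝ}
    (hJ : ∀ f : ℝ → ℝ, Continuous f → (∃ M, ∀ x, |f x| ≤ M) →
      ∫ x, f x ∂ν ≤ J + Real.log (∫ x, Real.exp (f x) ∂μ)) :
    ν ≪ μ ∧ Integrable (llr ν μ) ν ∧ ∫ x, llr ν μ x ∂ν ≤ J := by
  have hJ0 : 0 ≤ J := by
    have := hJ (fun _ => 0) continuous_const ⟨0, by simp⟩
    simpa using this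
  have hac : ν ≪ μ := by
    refine Measure.AbsolutelyContinuous.mk fun A hA hμA => ?_
    by_contra hne
    have hpos : 0 < ν.real A := by
      rw [measureReal_def]; exact ENNReal.toReal_pos hne (measure_ne_top _ _)
    set M := (J + 1) / ν.real A with hM
    have hM0 : 0 ≤ M := by positivity
    have := dv_meas hJ (f := A.indicator fun _ => M) (measurable_const.indicator hA) (M := M) (by
      intro x
      by_cases hx : x ∈ A
      · simp [hx, abs_of_nonneg hM0]
      · simp [hx, hM0])
    rw [integral_indicator_const _ hA] at this
    have e : ∫ x, Real.exp (A.indicator (fun _ => M) x) ∂μ = 1 := by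
      have : (fun x => Real.exp (A.indicator (fun _ => M) x)) =ᵐ[μ] fun _ => 1 := by
        have h : ∀ᵐ x ∂μ, x ∉ A := by rw [ae_iff]; simpa using hμA
        filter_upwards [h] with x hx
        simp [hx]
      rw [integral_congr_ae this]; simp
    rw [e, Real.log_one, smul_eq_mul, hM, mul_div_cancel₀ _ hpos.ne'] at this
    linarith
  set r : ℝ → ℝ := fun x => (ν.rnDeriv μ x).toReal with hr
  have hrm : Measurable r := (Measure.measurable_rnDeriv _ _).ennreal_toReal
  have hr0 : ∀ x, 0 ≤ r x := fun x => ENNReal.toReal_nonneg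
  have hri : Integrable r μ := Measure.integrable_toReal_rnDeriv
  have hr1 : ∫ x, r x ∂μ = 1 := by
    rw [hr, Measure.integral_toReal_rnDeriv hac]; simp
  set y : ℕ → ℝ → ℝ := fun n x => max (Real.exp (-((n:ℝ)+1))) (min (r x) (Real.exp ((n:ℝ)+1))) with hy
  have hyl : ∀ (n : ℕ) x, Real.exp (-((n:ℝ)+1)) ≤ y n x := fun n x => le_max_left _ _
  have hyu : ∀ (n : ℕ) x, y n x ≤ Real.exp ((n:ℝ)+1) := fun n x => max_le
    (Real.exp_le_exp.mpr (by linarith [(Nat.cast_nonneg n : (0:ℝ) ≤ n)])) (min_le_right _ _)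
  have hy0 : ∀ (n : ℕ) x, 0 < y n x := fun n x => (Real.exp_pos _).trans_le (hyl n x)
  have hym : ∀ n, Measurable (y n) := fun n => by simp only [hy]; fun_prop
  have hyr : ∀ (n : ℕ) x, y n x ≤ r x + Real.exp (-((n:ℝ)+1)) := fun n x => by
    refine max_le (by linarith [hr0 x]) ((min_le_left _ _).trans ?_)
    linarith [Real.exp_pos (-((n:ℝ)+1))]
  have hlb : ∀ (n : ℕ) x, |Real.log (y n x)| ≤ (n:ℝ)+1 := fun n x => by
    rw [abs_le]
    exact ⟨(Real.le_log_iff_exp_le (hy0 n x)).mpr (hyl n x),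
      (Real.log_le_iff_le_exp (hy0 n x)).mpr (hyu n x)⟩
  have hlm : ∀ n, Measurable fun x => Real.log (y n x) := fun n => (hym n).log
  have hub : ∀ n : ℕ, ∫ x, Real.log (y n x) ∂ν ≤ J + Real.exp (-((n:ℝ)+1)) := by
    intro n
    refine (dv_meas hJ (hlm n) (hlb n)).trans ?_
    simp only [Real.exp_log (hy0 n _)]
    have hyi : Integrable (y n) μ := by
      refine Integrable.of_bound (hym n).aestronglyMeasurable (Real.exp ((n:ℝ)+1)) (ae_of_all _ fun x => ?_)
      rw [Real.norm_of_nonneg (hy0 n x).le]; exact hyu n x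
    have h1 : ∫ x, y n x ∂μ ≤ 1 + Real.exp (-((n:ℝ)+1)) := by
      have := integral_mono hyi (hri.add (integrable_const (Real.exp (-((n:ℝ)+1))))) (hyr n)
      simp only [Pi.add_apply] at this
      rw [integral_add hri (integrable_const _), hr1] at this
      simpa using this
    have h2 : Real.exp (-((n:ℝ)+1)) ≤ ∫ x, y n x ∂μ := by
      have := integral_mono (integrable_const (Real.exp (-((n:ℝ)+1)))) hyi (hyl n)
      simpa using this
    have h3 := Real.log_le_sub_one_of_pos ((Real.exp_pos _).trans_le h2)
    linarith
  set k : ℕ → ℝ → ℝ := fun n x => r x * Real.log (y n x) + 1 - r x with hk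
  have hk0 : ∀ (n : ℕ) x, 0 ≤ k n x := by
    intro n x
    have hn : (0:ℝ) ≤ n := Nat.cast_nonneg n
    simp only [hk]
    by_cases hxr : r x ≤ Real.exp ((n:ℝ)+1)
    · have hyx : r x ≤ y n x := by
        simp only [hy]; rw [min_eq_left hxr]; exact le_max_right _ _
      rcases eq_or_lt_of_le (hr0 x) with h | h
      · rw [← h]; simp
      · have h1 : Real.log (r x) ≤ Real.log (y n x) := Real.log_le_log h hyx
        have h2 := Real.one_sub_inv_le_log_of_pos h
        have h3 := mul_le_mul_of_nonneg_left (h2.trans h1) (hr0 x)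
        have h4 : r x * (1 - (r x)⁻¹) = r x - 1 := by field_simp
        linarith
    · have hyx : y n x = Real.exp ((n:ℝ)+1) := by
        simp only [hy]; rw [min_eq_right (le_of_not_ge hxr)]
        exact max_eq_right (Real.exp_le_exp.mpr (by linarith))
      rw [hyx, Real.log_exp]
      nlinarith [hr0 x]
  have hkm : ∀ n, Measurable (k n) := fun n => by
    have := hlm n
    simp only [hk]; fun_prop
  have hklim : ∀ x, Tendsto (fun n => k n x) atTop (𝓝 (InformationTheory.klFun (r x))) := by
    intro x
    rcases eq_or_lt_of_le (hr0 x) with h | h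
    · simp only [hk, ← h]; simp [InformationTheory.klFun]
    · refine Tendsto.congr' ?_ tendsto_const_nhds
      obtain ⟨m, hm⟩ := exists_nat_ge |Real.log (r x)|
      rw [abs_le] at hm
      filter_upwards [eventually_ge_atTop m] with n hn
      have hn' : (m:ℝ) ≤ n := by exact_mod_cast hn
      have e : y n x = r x := by
        simp only [hy]
        rw [min_eq_left ((Real.log_le_iff_le_exp h).mp (by linarith)),
          max_eq_right ((Real.le_log_iff_exp_le h).mp (by linarith))]
      simp only [hk, e, InformationTheory.klFun]
  have hki : ∀ n : ℕ, ∫⁻ x, ENNReal.ofReal (k n x) ∂μ ≤ ENNReal.ofReal (J + Real.exp (-((n:ℝ)+1))) := by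
    intro n
    have il : Integrable (fun x => Real.log (y n x)) ν :=
      Integrable.of_bound (hlm n).aestronglyMeasurable ((n:ℝ)+1) (ae_of_all _ (hlb n))
    have i1 : Integrable (fun x => r x * Real.log (y n x)) μ :=
      (integrable_rnDeriv_smul_iff hac).mpr il
    have e1 : ∫ x, r x * Real.log (y n x) ∂μ = ∫ x, Real.log (y n x) ∂ν := integral_rnDeriv_smul hac
    have i2 : Integrable (fun x => r x * Real.log (y n x) + 1) μ := i1.add (integrable_const _)
    have i3 : Integrable (k n) μ := i2.sub hri
    rw [← ofReal_integral_eq_lintegral_ofReal i3 (ae_of_all _ (hk0 n))]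
    refine ENNReal.ofReal_le_ofReal ?_
    simp only [hk]
    rw [integral_sub i2 hri, integral_add i1 (integrable_const _), hr1, e1]
    simpa using hub n
  have hkl : InformationTheory.klDiv ν μ ≤ ENNReal.ofReal J := by
    rw [InformationTheory.klDiv_eq_lintegral_klFun_of_ac hac]
    have e : ∀ x, ENNReal.ofReal (InformationTheory.klFun (ν.rnDeriv μ x).toReal) =
        liminf (fun n => ENNReal.ofReal (k n x)) atTop := fun x =>
      ((ENNReal.tendsto_ofReal (hklim x)).liminf_eq).symm
    simp only [e]
    refine (lintegral_liminf_le fun n => (hkm n).ennreal_ofReal).trans ?_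
    have hz : Tendsto (fun n : ℕ => ENNReal.ofReal (J + Real.exp (-((n:ℝ)+1)))) atTop
        (𝓝 (ENNReal.ofReal J)) := by
      refine ENNReal.tendsto_ofReal ?_
      have h1 : Tendsto (fun n : ℕ => Real.exp (-((n:ℝ)+1))) atTop (𝓝 0) :=
        Real.tendsto_exp_neg_atTop_nhds_zero.comp
          (tendsto_atTop_add_const_right _ _ tendsto_natCast_atTop_atTop)
      simpa using h1.const_add J
    rw [← hz.liminf_eq]
    exact liminf_le_liminf (Eventually.of_forall hki)
  have hne : InformationTheory.klDiv ν μ ≠ ⊤ := ne_top_of_le_ne_top ENNReal.ofReal_ne_top hkl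
  refine ⟨hac, (InformationTheory.klDiv_ne_top_iff.mp hne).2, ?_⟩
  rw [← InformationTheory.toReal_klDiv_of_measure_eq hac (by simp)]
  exact ENNReal.toReal_le_of_le_ofReal hJ0 hkl

lemma log_lb {s : ℝ} (h0 : 0 ≤ s) (h1 : s < 1) : s + s^2/4 ≤ -Real.log (1 - s) := by
  set w := Real.sqrt (1 - s) with hw
  have hw2 : w^2 = 1 - s := Real.sq_sqrt (by linarith)
  have hw0 : 0 < w := Real.sqrt_pos.mpr (by linarith)
  have hw1 : w ≤ 1 := by nlinarith
  have hl : Real.log (1 - s) = 2 * Real.log w := by rw [← hw2, Real.log_pow]; norm_num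
  have h2 := Real.log_le_sub_one_of_pos hw0
  have h3 : s = (1 - w) * (1 + w) := by nlinarith
  have h4 : s ≤ 2 * (1 - w) := by nlinarith
  have h5 : s^2 ≤ (2 * (1 - w))^2 := pow_le_pow_left₀ h0 h4 2
  nlinarith

def tk (g : ℝ) (u : ℕ → ℝ) (k : ℕ) : ℝ := -Real.log (1 - (u (k+1))^2) + g * (u (k+1))^2

def ek (g : ℝ) (u : ℕ → ℝ) (k : ℕ) : ℝ := -(g/2) * (u (k+1) - u k)^2 + tk g u k

lemma tk_lb {g : ℝ} (hg1 : -1 ≤ g) {u : ℕ → ℝ}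
    (hu : ∀ k : ℕ, u (k+1) ∈ Ioo (-1 : ℝ) 1) (k : ℕ) : (u (k+1))^4/4 ≤ tk g u k := by
  have h := hu k
  have h1 : (u (k+1))^2 < 1 := by rw [sq_lt_one_iff_abs_lt_one, abs_lt]; exact h
  have := log_lb (sq_nonneg (u (k+1))) h1
  unfold tk
  nlinarith [sq_nonneg (u (k+1))]

lemma tk_nonneg {g : ℝ} (hg1 : -1 ≤ g) {u : ℕ → ℝ}
    (hu : ∀ k : ℕ, u (k+1) ∈ Ioo (-1 : ℝ) 1) (k : ℕ) : 0 ≤ tk g u k :=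
  le_trans (by positivity) (tk_lb hg1 hu k)

lemma ek_lb {g : ℝ} (hg1 : -1 ≤ g) (hg0 : g ≤ 0) {u : ℕ → ℝ}
    (hu : ∀ k : ℕ, u (k+1) ∈ Ioo (-1 : ℝ) 1) (k : ℕ) : (u (k+1))^4/4 ≤ ek g u k := by
  have := tk_lb hg1 hu k
  have h2 : 0 ≤ -(g/2) * (u (k+1) - u k)^2 := mul_nonneg (by linarith) (sq_nonneg _)
  unfold ek; linarith

lemma ek_nonneg {g : ℝ} (hg1 : -1 ≤ g) (hg0 : g ≤ 0) {u : ℕ → ℝ}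
    (hu : ∀ k : ℕ, u (k+1) ∈ Ioo (-1 : ℝ) 1) (k : ℕ) : 0 ≤ ek g u k :=
  le_trans (by positivity) (ek_lb hg1 hg0 hu k)

lemma Jn_id (g : ℝ) {u : ℕ → ℝ} (h0 : u 0 = -1) (n : ℕ) :
    Jn g u n = Hgw g + g/2 + ∑ k ∈ Finset.range n, ek g u k - (g/2) * (u n)^2 := by
  induction n with
  | zero => simp [Jn, h0]
  | succ n ih =>
    have : Jn g u (n+1) = Jn g u n + g * (u (n+1) * u n) - Real.log (1 - u (n+1)^2) := by
      simp only [Jn, Finset.sum_range_succ]; ring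
    rw [this, ih, Finset.sum_range_succ]
    simp only [ek, tk]; ring

lemma rhs_eq {g : ℝ} (hg1 : -1 ≤ g) (hg0 : g ≤ 0) {u : ℕ → ℝ}
    (hu : ∀ k : ℕ, u (k+1) ∈ Ioo (-1 : ℝ) 1) :
    ENNReal.ofReal (-(g/2)) * ∑' k : ℕ, ENNReal.ofReal ((u (k+1) - u k)^2)
      + ∑' k : ℕ, ENNReal.ofReal (-Real.log (1 - (u (k+1))^2) + g * (u (k+1))^2)
      = ∑' k : ℕ, ENNReal.ofReal (ek g u k) := by
  rw [← ENNReal.tsum_mul_left, ← ENNReal.tsum_add]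
  refine tsum_congr fun k => ?_
  have hg : 0 ≤ -(g/2) := by linarith
  rw [← ENNReal.ofReal_mul hg]
  change _ + ENNReal.ofReal (tk g u k) = _
  rw [← ENNReal.ofReal_add (mul_nonneg hg (sq_nonneg _)) (tk_nonneg hg1 hu k)]
  rfl

lemma main_finite {g : ℝ} (hg1 : -1 ≤ g) (hg0 : g ≤ 0)
    {μ : Measure ℝ} [IsProbabilityMeasure μ] (hsupp : μ (Icc (-2) 2)ᶜ = 0)
    {u : ℕ → ℝ} (hu' : IsCanonicalMoments μ u) (hs : Summable (ek g u)) :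
    KLdiv (mugMix g) μ + ENNReal.ofReal (-(Hgw g + g/2)) = ENNReal.ofReal (∑' k, ek g u k) := by
  have h0 := hu'.1
  have hu := hu'.2.1
  have := mug_prob hg1 hg0
  have hu4 : Tendsto (fun k => (u (k+1))^4) atTop (𝓝 0) := by
    refine squeeze_zero (g := fun k => 4 * ek g u k) (fun k => by positivity)
      (fun k => by linarith [ek_lb hg1 hg0 hu k]) ?_
    simpa using hs.tendsto_atTop_zero.const_mul 4
  have hu1 : Tendsto (fun k => u (k+1)) atTop (𝓝 0) := by
    rw [Metric.tendsto_atTop] at hu4 ⊢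
    intro ε hε
    obtain ⟨N, hN⟩ := hu4 (ε^4) (by positivity)
    refine ⟨N, fun n hn => ?_⟩
    have := hN n hn
    rw [Real.dist_eq, sub_zero, abs_pow] at this
    rw [Real.dist_eq, sub_zero]
    exact lt_of_pow_lt_pow_left₀ 4 hε.le this
  have hun : Tendsto u atTop (𝓝 0) := (tendsto_add_atTop_iff_nat 1).mp hu1
  set J := Hgw g + g/2 + ∑' k, ek g u k with hJdef
  have hJn : Tendsto (Jn g u) atTop (𝓝 J) := by
    have e : Jn g u = fun n => Hgw g + g/2 + ∑ k ∈ Finset.range n, ek g u k - (g/2) * (u n)^2 :=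
      funext fun n => Jn_id g h0 n
    rw [e]
    have h1 := (hs.hasSum.tendsto_sum_nat.const_add (Hgw g + g/2)).sub ((hun.pow 2).const_mul (g/2))
    simpa using h1
  have hcn : Tendsto (fun n => Real.log (cn g u n)) atTop (𝓝 0) := by
    have h1 : Tendsto (cn g u) atTop (𝓝 1) := by
      unfold cn
      simpa using ((hu1.mul hun).const_mul g).const_sub 1
    simpa using h1.log one_ne_zero
  obtain ⟨hac, hint, hle⟩ := rev_dv (μ := μ) (ν := mugMix g) (J := J) (by
    intro f hf ⟨M, hM⟩
    have hlim := cont_limit hsupp hu' (f := fun x => Real.exp (f x))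
      (Real.continuous_exp.comp hf).continuousOn
    have hi : Integrable (fun x => Real.exp (f x)) μ := by
      refine Integrable.of_bound (Real.continuous_exp.comp hf).aestronglyMeasurable (Real.exp M)
        (ae_of_all _ fun x => ?_)
      rw [Real.norm_of_nonneg (Real.exp_pos _).le]
      exact Real.exp_le_exp.mpr (abs_le.mp (hM x)).2
    have hpos : 0 < ∫ x, Real.exp (f x) ∂μ := integral_exp_pos hi
    exact ge_of_tendsto' (hJn.add (hlim.log hpos.ne')) fun n => upper_bd hg1 hg0 h0 hu hf n)
  have hge : J ≤ ∫ x, llr (mugMix g) μ x ∂(mugMix g) := by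
    have h1 := hJn.sub hcn
    rw [sub_zero] at h1
    exact le_of_tendsto' h1 fun n => lower_bd hg1 hg0 hsupp hu' hac hint n
  have heq := le_antisymm hle hge
  have hJ0 : 0 ≤ J := by
    have := InformationTheory.integral_llr_add_sub_measure_univ_nonneg hac hint
    simp at this
    linarith
  unfold KLdiv
  rw [if_pos ⟨hac, hint⟩, heq, ← ENNReal.ofReal_add hJ0 (by linarith [hgw_le hg1 hg0])]
  congr 1
  rw [hJdef]; ring

lemma main_infinite {g : ℝ} (hg1 : -1 ≤ g) (hg0 : g ≤ 0)
    {μ : Measure ℝ} [IsProbabilityMeasure μ] (hsupp : μ (Icc (-2) 2)ᶜ = 0)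
    {u : ℕ → ℝ} (hu' : IsCanonicalMoments μ u) (hs : ¬ Summable (ek g u)) :
    KLdiv (mugMix g) μ = ⊤ := by
  have h0 := hu'.1
  have hu := hu'.2.1
  unfold KLdiv
  rw [if_neg]
  rintro ⟨hac, hint⟩
  refine hs (summable_of_sum_range_le (c := ∫ x, llr (mugMix g) μ x ∂(mugMix g) + Real.log 2
    - (Hgw g + g/2)) (fun k => ek_nonneg hg1 hg0 hu k) fun n => ?_)
  have h1 := lower_bd hg1 hg0 hsupp hu' hac hint n
  obtain ⟨c1, c2⟩ := cn_bd hg1 hg0 h0 hu n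
  have h2 := Real.log_le_log c1 c2
  rw [Jn_id g h0] at h1
  have h3 : 0 ≤ -(g/2) * (u n)^2 := mul_nonneg (by linarith) (sq_nonneg _)
  linarith

/-- New sum rule obtained from the Gross–Witten sum rule via the Szegő mapping.
The finite constant `H(g) + g/2 (≤ 0)` has been moved to the left-hand side. -/
theorem gw_szego_sum_rule (g : ℝ) (hg1 : -1 ≤ g) (hg0 : g ≤ 0)
    (μ : Measure ℝ) [IsProbabilityMeasure μ] (hsupp : μ (Icc (-2) 2)ᶜ = 0)
    (hnt : InfiniteSupport μ) (u : ℕ → ℝ) (hu : IsCanonicalMoments μ u) :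
    KLdiv (mugMix g) μ + ENNReal.ofReal (-(Hgw g + g/2)) =
      ENNReal.ofReal (-(g/2)) * ∑' k : ℕ, ENNReal.ofReal ((u (k+1) - u k)^2)
      + ∑' k : ℕ, ENNReal.ofReal (-Real.log (1 - (u (k+1))^2) + g * (u (k+1))^2) := by
  have hu1 := hu.2.1
  rw [rhs_eq hg1 hg0 hu1]
  by_cases hs : Summable (ek g u)
  · rw [main_finite hg1 hg0 hsupp hu hs, ENNReal.ofReal_tsum_of_nonneg (ek_nonneg hg1 hg0 hu1) hs]
  · rw [main_infinite hg1 hg0 hsupp hu hs, top_add]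
    by_contra hne
    refine hs ?_
    have h := ENNReal.summable_toReal (Ne.symm hne)
    refine h.congr fun k => ?_
    rw [ENNReal.toReal_ofReal (ek_nonneg hg1 hg0 hu1 k)]

end SumRules
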